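/- arXiv:1105.0841 — 2 statements merged into one kernel-verified Lean document; each statement's English description precedes it below -/
import Mathlib

section
/- Let n ≥ 3 be an integer. There exists a constant C_n > 0 depending only on n such that for every integer s ≥ 1, every real T ≥ 1 and every real D > 0, the number of vectors a in G(T) with X_s(a) ≥ D is at most C_n · D^{-(n-1)} · #G(T), where G(T) = {a ∈ ℤ^n_{>0} : gcd(a_1,…,a_n) = 1, max_i a_i ≤ T} and X_s(a) = F_s(a)/(s·a_1·…·a_n)^{1/(n-1)}. -/
namespace SFrob
open Finset

lemma norm_char_sub_one {m : ℕ} [NeZero m] (x : ZMod m) :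
    4 * (|(x.valMinAbs : ℝ)| / m) ≤ ‖(ZMod.stdAddChar x : ℂ) - 1‖ := by
  have hm : (0:ℝ) < m := by exact_mod_cast Nat.pos_of_ne_zero (NeZero.ne m)
  set w := x.valMinAbs with hw
  have h1 : (ZMod.stdAddChar x : ℂ) = Complex.exp (Complex.I * ((2 * Real.pi * w / m : ℝ) : ℂ)) := by
    conv_lhs => rw [← ZMod.coe_valMinAbs x]
    rw [ZMod.stdAddChar_coe]
    congr 1
    push_cast
    ring
  rw [h1, Complex.norm_exp_I_mul_ofReal_sub_one]
  have h2 : (w.natAbs : ℝ) ≤ m / 2 := by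
    have := ZMod.natAbs_valMinAbs_le x
    have h3 : 2 * w.natAbs ≤ m := by omega
    have h4 : (2:ℝ) * w.natAbs ≤ m := by exact_mod_cast h3
    linarith
  have h3 : |(w:ℝ)| ≤ m / 2 := by
    rw [Nat.cast_natAbs, Int.cast_abs] at h2; exact h2
  have h4 : |(w:ℝ)| / m ≤ 1 / 2 := by
    rw [div_le_iff₀ hm]; linarith
  have h5 : ‖2 * Real.sin (2 * Real.pi * w / m / 2)‖ = 2 * |Real.sin (Real.pi * (|(w:ℝ)| / m))| := by
    rw [Real.norm_eq_abs, abs_mul, abs_two]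
    congr 1
    rcases abs_cases (w:ℝ) with ⟨h, _⟩ | ⟨h, _⟩
    · rw [h]; congr 2; ring
    · rw [h, show Real.pi * (-(w:ℝ) / m) = -(2 * Real.pi * w / m / 2) by ring, Real.sin_neg, abs_neg]
  rw [h5]
  have h6 := Real.mul_le_sin (x := Real.pi * (|(w:ℝ)| / m)) (by positivity)
    (by nlinarith [Real.pi_pos])
  have h7 : 2 / Real.pi * (Real.pi * (|(w:ℝ)| / m)) = 2 * (|(w:ℝ)| / m) := by
    field_simp
  have h8 := le_abs_self (Real.sin (Real.pi * (|(w:ℝ)| / m)))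
  linarith

lemma norm_geom {m : ℕ} [NeZero m] (x : ZMod m) (K : ℕ) :
    |(x.valMinAbs : ℝ)| / m * ‖∑ y ∈ range K, (ZMod.stdAddChar (x * (y : ZMod m)) : ℂ)‖ ≤ 1 / 2 := by
  have h1 : ∀ y : ℕ, (ZMod.stdAddChar (x * (y : ZMod m)) : ℂ) = (ZMod.stdAddChar x : ℂ) ^ y := by
    intro y
    rw [← AddChar.map_nsmul_eq_pow, nsmul_eq_mul, mul_comm]
  simp_rw [h1]
  have h2 := mul_geom_sum (ZMod.stdAddChar x : ℂ) K
  have h3 := congrArg norm h2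
  rw [norm_mul] at h3
  have hn : ‖(ZMod.stdAddChar x : ℂ)‖ = 1 := AddChar.norm_apply _ _
  have h4 : ‖(ZMod.stdAddChar x : ℂ) ^ K - 1‖ ≤ 2 := by
    refine (norm_sub_le _ _).trans ?_
    rw [norm_pow, hn]; norm_num
  have h5 := norm_char_sub_one x
  have h6 := mul_le_mul_of_nonneg_right h5 (norm_nonneg (∑ i ∈ range K, (ZMod.stdAddChar x : ℂ) ^ i))
  linarith

noncomputable def g (c : ℝ) (q : ℤ) : ℝ := if q = 0 then 1 else 1 / (c * q) ^ 2

lemma g_nonneg (c : ℝ) (q : ℤ) : 0 ≤ g c q := by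
  unfold g; split_ifs <;> positivity

lemma sum_g {c : ℝ} (hc : 0 < c) (M : ℕ) : ∑ q ∈ Icc (-(M:ℤ)) M, g c q ≤ 1 + 4 / c ^ 2 := by
  rw [Finset.sum_Icc_of_even_eq_range]
  · have key : ∀ M : ℕ, ∑ m ∈ range (M + 1), g c (m:ℤ) ≤ 1 + (2 - 1 / (M:ℝ)) / c ^ 2 := by
      intro M
      induction M with
      | zero => simp [g]; positivity
      | succ k ih =>
        rw [Finset.sum_range_succ]
        have : g c ((k+1 : ℕ):ℤ) = (1 / ((k:ℝ)+1)^2) / c^2 := by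
          unfold g
          rw [if_neg (by omega)]
          push_cast
          rw [mul_pow, div_div]; ring_nf
        rw [this]
        rcases Nat.eq_zero_or_pos k with rfl | hk
        · simp [g]; norm_num
        · have hk' : (0:ℝ) < k := by exact_mod_cast hk
          have h1 : 1 / ((k:ℝ)+1)^2 ≤ 1/(k:ℝ) - 1/((k:ℝ)+1) := by
            rw [div_sub_div _ _ (by positivity) (by positivity), div_le_div_iff₀ (by positivity) (by positivity)]
            nlinarith
          have h2 : (2 - 1 / (k:ℝ)) / c ^ 2 + 1 / ((k:ℝ)+1)^2 / c^2 ≤ (2 - 1/((k:ℝ)+1)) / c^2 := by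
            rw [← add_div]
            apply div_le_div_of_nonneg_right _ (by positivity)
            linarith
          push_cast
          linarith
    have h := key M
    simp only [nsmul_eq_mul]
    have h0 : g c 0 = 1 := by simp [g]
    rw [h0]
    have : (2 - 1 / (M:ℝ)) / c ^ 2 ≤ 2 / c^2 := by
      apply div_le_div_of_nonneg_right _ (by positivity)
      have : (0:ℝ) ≤ 1 / (M:ℝ) := by positivity
      linarith
    have e : 4 / c^2 = 2 * (2 / c^2) := by ring
    push_cast
    rw [e]; linarith
  · intro q
    simp [g]

lemma norm_S_sq_le {m : ℕ} [NeZero m] {c : ℝ} (hc : 0 < c) (x : ZMod m) (K : ℕ) :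
    ‖∑ y ∈ range K, (ZMod.stdAddChar (x * (y : ZMod m)) : ℂ)‖ ^ 2
      ≤ (K : ℝ) ^ 2 * g c (round ((K : ℝ) * x.valMinAbs / (c * m))) := by
  have hm : (0:ℝ) < m := by exact_mod_cast Nat.pos_of_ne_zero (NeZero.ne m)
  set q := round ((K : ℝ) * x.valMinAbs / (c * m)) with hq
  set S := ‖∑ y ∈ range K, (ZMod.stdAddChar (x * (y : ZMod m)) : ℂ)‖ with hS
  have hS0 : 0 ≤ S := norm_nonneg _
  by_cases h : q = 0
  · have : S ≤ K := by
      refine (norm_sum_le _ _).trans ?_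
      simp
    simp only [g, h, if_true, mul_one]
    gcongr
  · have h1 := norm_geom x K
    rw [← hS] at h1
    have h2 : |(K : ℝ) * x.valMinAbs / (c * m) - q| ≤ 1/2 := abs_sub_round _
    have h3 : (1:ℝ) ≤ |(q:ℝ)| := by
      have := Int.one_le_abs h
      exact_mod_cast this
    have h4 : |(q:ℝ)| - 1/2 ≤ |(K : ℝ) * x.valMinAbs / (c * m)| := by
      have := abs_sub_abs_le_abs_sub (q:ℝ) ((K : ℝ) * x.valMinAbs / (c * m))
      rw [abs_sub_comm] at this
      linarith
    have h5 : |(K : ℝ) * x.valMinAbs / (c * m)| = K * (|(x.valMinAbs:ℝ)| / m) / c := by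
      rw [abs_div, abs_mul, abs_mul, abs_of_pos hc, abs_of_pos hm, abs_of_nonneg (by positivity : (0:ℝ) ≤ K)]
      field_simp
    rw [h5, le_div_iff₀ hc] at h4
    have h6 : |(q:ℝ)| * c / 2 ≤ K * (|(x.valMinAbs:ℝ)| / m) := by nlinarith
    have h7 : |(q:ℝ)| * c * S ≤ K := by
      have a1 := mul_le_mul_of_nonneg_right h6 hS0
      have a2 := mul_le_mul_of_nonneg_left h1 (by positivity : (0:ℝ) ≤ K)
      nlinarith
    simp only [g, h, if_false]
    rw [mul_one_div, le_div_iff₀ (by have : (q:ℝ) ≠ 0 := by exact_mod_cast h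
                                     positivity)]
    have h8 : (|(q:ℝ)| * c * S)^2 ≤ (K:ℝ)^2 := by gcongr
    calc S^2 * (c * q)^2 = (|(q:ℝ)| * c * S)^2 := by
          rw [mul_pow, mul_pow, mul_pow, sq_abs]; ring
      _ ≤ _ := h8

lemma map_sum_prod {ι : Type*} [Fintype ι] {m : ℕ} (ψ : AddChar (ZMod m) ℂ) (f : ι → ZMod m) :
    ψ (∑ i, f i) = ∏ i, ψ (f i) := by
  classical
  induction (univ : Finset ι) using Finset.induction_on with
  | empty => simp
  | insert a s ha ih => rw [Finset.sum_insert ha, Finset.prod_insert ha, AddChar.map_add_eq_mul, ih]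

lemma flat {ι : Type*} [Fintype ι] [DecidableEq ι] {m : ℕ} [NeZero m] (a : ι → ZMod m) (K : ι → ℕ)
    (hK : ∀ i, 0 < K i) {c : ℝ} (hc : 0 < c) (hc2 : (1 + 4 / c ^ 2) ^ (Fintype.card ι) < 2)
    (H : ∀ x : ZMod m, x ≠ 0 → ∃ i, c * m < K i * |((x * a i).valMinAbs : ℝ)|) (r : ZMod m) :
    ∃ z : ι → ℕ, (∀ i, z i ≤ 2 * (K i - 1)) ∧ ∑ i, a i * (z i : ZMod m) = r := by
  classical
  by_contra hcon
  push Not at hcon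
  have hm : (0:ℝ) < m := by exact_mod_cast Nat.pos_of_ne_zero (NeZero.ne m)
  set Y := Fintype.piFinset (fun i => range (K i)) with hY
  set S : ZMod m → ι → ℂ := fun x i => ∑ y ∈ range (K i), (ZMod.stdAddChar (x * a i * (y : ZMod m)) : ℂ) with hSdef
  have hE : ∀ x : ZMod m, ∏ i, S x i = ∑ y ∈ Y, (ZMod.stdAddChar (x * ∑ i, a i * (y i : ZMod m)) : ℂ) := by
    intro x
    rw [hSdef]
    simp only
    rw [Finset.prod_univ_sum]
    refine Finset.sum_congr rfl fun y _ => ?_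
    have hms : ∀ f : ι → ZMod m, (ZMod.stdAddChar (∑ i, f i) : ℂ) = ∏ i, ZMod.stdAddChar (f i) := fun f => map_sum_prod _ f
    rw [Finset.mul_sum, hms]
    simp_rw [mul_assoc]
  have hzero : ∑ x : ZMod m, (ZMod.stdAddChar (x * (-r)) : ℂ) * (∏ i, S x i) ^ 2 = 0 := by
    have : ∀ x : ZMod m, (ZMod.stdAddChar (x * (-r)) : ℂ) * (∏ i, S x i) ^ 2 =
        ∑ y ∈ Y, ∑ y' ∈ Y, (ZMod.stdAddChar (x * (-r + ∑ i, a i * (y i : ZMod m) + ∑ i, a i * (y' i : ZMod m))) : ℂ) := by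
      intro x
      rw [hE, sq, Finset.sum_mul_sum, Finset.mul_sum]
      refine Finset.sum_congr rfl fun y _ => ?_
      rw [Finset.mul_sum]
      refine Finset.sum_congr rfl fun y' _ => ?_
      rw [mul_add, mul_add, AddChar.map_add_eq_mul, AddChar.map_add_eq_mul, mul_assoc]
    simp_rw [this]
    rw [Finset.sum_comm]
    refine Finset.sum_eq_zero fun y hy => ?_
    rw [Finset.sum_comm]
    refine Finset.sum_eq_zero fun y' hy' => ?_
    rw [AddChar.sum_mulShift _ (ZMod.isPrimitive_stdAddChar m), if_neg, Nat.cast_zero]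
    intro h
    refine hcon (fun i => y i + y' i) ?_ ?_
    · intro i
      have h1 := Finset.mem_range.1 (Fintype.mem_piFinset.1 hy i)
      have h2 := Finset.mem_range.1 (Fintype.mem_piFinset.1 hy' i)
      skip
      omega
    · simp only [Nat.cast_add, mul_add, Finset.sum_add_distrib]
      linear_combination h
  rw [← Finset.add_sum_erase _ _ (Finset.mem_univ (0 : ZMod m))] at hzero
  have hS0 : ∀ i, S 0 i = K i := by intro i; simp [hSdef]
  have hmain : ∏ i, (K i : ℝ) ^ 2 ≤ ∑ x ∈ univ.erase (0 : ZMod m), ∏ i, ‖S x i‖ ^ 2 := by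
    have h1 : ((∏ i, (K i : ℂ)) ^ 2) = - ∑ x ∈ univ.erase (0 : ZMod m), (ZMod.stdAddChar (x * (-r)) : ℂ) * (∏ i, S x i) ^ 2 := by
      simp only [hS0, zero_mul, AddChar.map_zero_eq_one, one_mul] at hzero
      linear_combination hzero
    have h2 := congrArg norm h1
    rw [norm_neg, norm_pow, norm_prod] at h2
    simp only [Complex.norm_natCast] at h2
    rw [Finset.prod_pow, h2]
    refine (norm_sum_le _ _).trans (Finset.sum_le_sum fun x _ => ?_)
    rw [norm_mul, AddChar.norm_apply, one_mul, norm_pow, norm_prod, Finset.prod_pow]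
  set q : ZMod m → ι → ℤ := fun x i => round ((K i : ℝ) * (x * a i).valMinAbs / (c * m)) with hq
  -- injectivity
  have hinj : Function.Injective q := by
    intro x x' hxx
    by_contra hne
    obtain ⟨i, hi⟩ := H (x - x') (sub_ne_zero.2 hne)
    have h1 : q x i = q x' i := by rw [hxx]
    have h2 := abs_sub_round ((K i : ℝ) * (x * a i).valMinAbs / (c * m))
    have h3 := abs_sub_round ((K i : ℝ) * (x' * a i).valMinAbs / (c * m))
    simp only [hq] at h1
    rw [h1] at h2
    set w := (x * a i).valMinAbs
    set w' := (x' * a i).valMinAbs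
    have h4 : (((x - x') * a i).valMinAbs).natAbs ≤ (w - w').natAbs := by
      apply ZMod.natAbs_min_of_le_div_two m
      · simp [w, w', sub_mul]
      · exact ZMod.natAbs_valMinAbs_le _
    have h5 : |(((x - x') * a i).valMinAbs : ℝ)| ≤ |(w:ℝ) - w'| := by
      rw [← Int.cast_sub, ← Int.cast_abs, ← Int.cast_abs, ← Int.natCast_natAbs, ← Int.natCast_natAbs]
      exact_mod_cast h4
    have h6 : |(K i : ℝ) * w / (c * m) - (K i : ℝ) * w' / (c * m)| ≤ 1 := by
      rw [abs_le] at h2 h3 ⊢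
      constructor <;> linarith [h2.1, h2.2, h3.1, h3.2]
    have h7 : |(K i : ℝ) * w / (c * m) - (K i : ℝ) * w' / (c * m)| = K i * |(w:ℝ) - w'| / (c * m) := by
      rw [← sub_div, ← mul_sub, abs_div, abs_mul, abs_of_pos (by positivity : 0 < c * (m:ℝ)), abs_of_nonneg (by positivity : (0:ℝ) ≤ K i)]
    rw [h7, div_le_one (by positivity)] at h6
    have h8 : (K i : ℝ) * |(((x - x') * a i).valMinAbs : ℝ)| ≤ K i * |(w:ℝ) - w'| := by gcongr
    linarith
  have hq0 : q 0 = 0 := by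
    funext i; simp [hq]
  obtain ⟨M, hM⟩ : ∃ M : ℕ, ∀ x i, q x i ∈ Icc (-(M:ℤ)) M := by
    refine ⟨∑ x, ∑ i, (q x i).natAbs, fun x i => ?_⟩
    have h1 : (q x i).natAbs ≤ ∑ x, ∑ i, (q x i).natAbs :=
      (Finset.single_le_sum (f := fun i => (q x i).natAbs) (fun _ _ => Nat.zero_le _) (mem_univ i)).trans
      (Finset.single_le_sum (f := fun x => ∑ i, (q x i).natAbs) (fun _ _ => Nat.zero_le _) (mem_univ x))
    rw [Finset.mem_Icc]
    omega
  have hsum : ∑ x : ZMod m, ∏ i, g c (q x i) ≤ (1 + 4 / c ^ 2) ^ (Fintype.card ι) := by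
    calc ∑ x : ZMod m, ∏ i, g c (q x i) = ∑ p ∈ univ.image q, ∏ i, g c (p i) := by
          rw [Finset.sum_image (fun x _ y _ h => hinj h)]
      _ ≤ ∑ p ∈ Fintype.piFinset (fun _ : ι => Icc (-(M:ℤ)) M), ∏ i, g c (p i) := by
          apply Finset.sum_le_sum_of_subset_of_nonneg
          · intro p hp
            obtain ⟨x, _, rfl⟩ := Finset.mem_image.1 hp
            exact Fintype.mem_piFinset.2 (hM x)
          · intro p _ _
            exact Finset.prod_nonneg fun i _ => g_nonneg _ _
      _ = ∏ _i : ι, ∑ p ∈ Icc (-(M:ℤ)) M, g c p := by rw [Finset.prod_univ_sum]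
      _ ≤ ∏ _i : ι, (1 + 4 / c ^ 2) := by
          apply Finset.prod_le_prod
          · intro i _; exact Finset.sum_nonneg fun p _ => g_nonneg _ _
          · intro i _; exact sum_g hc M
      _ = _ := by simp
  rw [← Finset.add_sum_erase _ _ (Finset.mem_univ (0 : ZMod m)), hq0] at hsum
  have h0 : ∏ i : ι, g c ((0 : ι → ℤ) i) = 1 := by simp [g]
  rw [h0] at hsum
  have hbd : ∑ x ∈ univ.erase (0 : ZMod m), ∏ i, ‖S x i‖ ^ 2 ≤
      (∏ i, (K i : ℝ) ^ 2) * ∑ x ∈ univ.erase (0 : ZMod m), ∏ i, g c (q x i) := by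
    rw [Finset.mul_sum]
    refine Finset.sum_le_sum fun x _ => ?_
    rw [← Finset.prod_mul_distrib]
    apply Finset.prod_le_prod
    · intro i _; positivity
    · intro i _; exact norm_S_sq_le hc (x * a i) (K i)
  have hP : 0 < ∏ i, (K i : ℝ) ^ 2 := by
    apply Finset.prod_pos
    intro i _
    have : (0:ℝ) < K i := by exact_mod_cast hK i
    positivity
  nlinarith


lemma reps {n : ℕ} (a : Fin n → ℕ) (ha : ∀ i, 0 < a i) (i1 : Fin n) (B t : ℝ) (ht : 0 ≤ t)
    (Hz : ∀ r : ZMod (a i1), ∃ ζ : Fin n → ℕ, ∑ i, (a i : ZMod (a i1)) * (ζ i : ZMod (a i1)) = r ∧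
      ∑ i, (a i : ℝ) * ζ i ≤ B) (b : ℤ) (hb : B + t ≤ b) :
    (t / n) ^ (n - 1) ≤ (∏ i, (a i : ℝ)) *
      ({z : Fin n → ℕ | ∑ i, (a i : ℤ) * (z i : ℤ) = b}.ncard : ℝ) := by
  classical
  have hn : 0 < n := i1.pos
  have : NeZero (a i1) := ⟨(ha i1).ne'⟩
  set Z := {z : Fin n → ℕ | ∑ i, (a i : ℤ) * (z i : ℤ) = b} with hZdef
  have hZ : Z.Finite := by
    apply (Fintype.piFinset (fun _ : Fin n => range (b.toNat + 1))).finite_toSet.subset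
    intro z hz
    rw [Finset.mem_coe, Fintype.mem_piFinset]
    intro i
    rw [Finset.mem_range]
    have h1 : (a i : ℤ) * z i ≤ b := by
      rw [← (show _ = b from hz)]
      exact Finset.single_le_sum (f := fun i => (a i : ℤ) * z i) (fun _ _ => by positivity) (mem_univ i)
    have h2 : (1:ℤ) ≤ a i := by exact_mod_cast ha i
    have h3 : (z i : ℤ) ≤ b := by nlinarith [Int.natCast_nonneg (z i)]
    omega
  choose ζ hζ1 hζ2 using Hz
  set k : Fin n → ℕ := fun i => ⌊t / n / a i⌋₊ with hk
  set Y := Fintype.piFinset (fun i => if i = i1 then {0} else range (k i + 1)) with hY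
  set R : (Fin n → ℕ) → ZMod (a i1) := fun y => (b : ZMod (a i1)) - ∑ i, (a i : ZMod (a i1)) * (y i : ZMod (a i1)) with hR
  set Φ0 : (Fin n → ℕ) → (Fin n → ℕ) := fun y => fun i => y i + ζ (R y) i +
     if i = i1 then ((b - ∑ i, (a i : ℤ) * (y i + ζ (R y) i : ℕ)) / (a i1 : ℤ)).toNat else 0 with hΦ0
  have hmem : ∀ y ∈ Y, Φ0 y ∈ Z := by
    intro y hy
    have hy' := Fintype.mem_piFinset.1 hy
    have h1 : ∑ i, (a i : ℝ) * y i ≤ t := by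
      calc ∑ i, (a i : ℝ) * y i ≤ ∑ _i : Fin n, t / n := by
            refine Finset.sum_le_sum fun i _ => ?_
            have hai : (0:ℝ) < a i := by exact_mod_cast ha i
            have := hy' i
            split_ifs at this with h
            · rw [Finset.mem_singleton] at this
              rw [this]; simp; positivity
            · rw [Finset.mem_range] at this
              have h2 : (y i : ℝ) ≤ t / n / a i := by
                refine le_trans ?_ (Nat.floor_le (by positivity))
                exact_mod_cast Nat.lt_succ_iff.1 this
              rw [le_div_iff₀ hai] at h2
              linarith
        _ = t := by simp; field_simp
    have h2 := hζ2 (R y)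
    set X : ℤ := b - ∑ i, (a i : ℤ) * (y i + ζ (R y) i : ℕ) with hX
    have hX0 : 0 ≤ X := by
      have : (0:ℝ) ≤ (X : ℝ) := by
        rw [hX]; push_cast
        simp only [mul_add, Finset.sum_add_distrib]
        linarith
      exact_mod_cast this
    have hXd : (a i1 : ℤ) ∣ X := by
      rw [← ZMod.intCast_zmod_eq_zero_iff_dvd, hX]
      have := hζ1 (R y)
      push_cast
      simp only [mul_add, Finset.sum_add_distrib]
      rw [this, hR]
      simp
    obtain ⟨q, hq⟩ := hXd
    have hq0 : 0 ≤ q := by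
      have : (0:ℤ) < a i1 := by exact_mod_cast ha i1
      by_contra hneg
      push Not at hneg
      nlinarith
    show ∑ i, (a i : ℤ) * (Φ0 y i : ℤ) = b
    have e : ∀ i, (a i : ℤ) * (Φ0 y i : ℤ) = (a i : ℤ) * (y i + ζ (R y) i : ℕ) + if i = i1 then X else 0 := by
      intro i
      simp only [hΦ0]
      rw [← hX]
      split_ifs with h
      · subst h
        have : (X / (a i : ℤ)).toNat = q := by
          rw [hq, Int.mul_ediv_cancel_left _ (by exact_mod_cast (ha i).ne')]
          omega
        rw [Nat.cast_add, this, hq]; push_cast; ring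
      · simp
    simp_rw [e]
    rw [Finset.sum_add_distrib, Finset.sum_ite_eq' univ i1]
    simp [hX]
  have hcard : Y.card ≤ (hZ.toFinset ×ˢ (univ : Finset (ZMod (a i1)))).card := by
    apply Finset.card_le_card_of_injOn (fun y => (Φ0 y, R y))
    · intro y hy
      simp only [Finset.coe_product, Set.mem_prod, Finset.mem_coe, Set.Finite.mem_toFinset, mem_univ, and_true]
      exact hmem y hy
    · intro y hy y' hy' h
      simp only [Prod.mk.injEq] at h
      obtain ⟨h1, h2⟩ := h
      funext i
      by_cases hi : i = i1
      · have e1 := Fintype.mem_piFinset.1 hy i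
        have e2 := Fintype.mem_piFinset.1 hy' i
        simp only [hi, if_true, Finset.mem_singleton] at e1 e2
        rw [hi, e1, e2]
      · have := congrFun h1 i
        simp only [hΦ0, h2, hi, if_false] at this
        omega
  have hcard2 : (Y.card : ℝ) ≤ a i1 * (Z.ncard : ℝ) := by
    rw [Finset.card_product, Finset.card_univ, ZMod.card, ← Set.ncard_eq_toFinset_card Z hZ] at hcard
    have : (Y.card : ℝ) ≤ ((Z.ncard * a i1 : ℕ) : ℝ) := by exact_mod_cast hcard
    push_cast at this; linarith
  have hYc : (Y.card : ℝ) = ∏ i ∈ univ.erase i1, ((k i : ℝ) + 1) := by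
    rw [hY, Fintype.card_piFinset, ← Finset.mul_prod_erase univ _ (mem_univ i1)]
    simp only [if_true, Finset.card_singleton, one_mul]
    push_cast
    refine Finset.prod_congr rfl fun i hi => ?_
    rw [if_neg (Finset.ne_of_mem_erase hi)]
    simp
  have hlow : (t / n) ^ (n - 1) ≤ (∏ i ∈ univ.erase i1, (a i : ℝ)) * ∏ i ∈ univ.erase i1, ((k i : ℝ) + 1) := by
    rw [← Finset.prod_mul_distrib]
    have : (t / n : ℝ) ^ (n - 1) = ∏ i ∈ univ.erase i1, (t / n : ℝ) := by
      rw [Finset.prod_const, Finset.card_erase_of_mem (mem_univ _)]; simp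
    rw [this]
    apply Finset.prod_le_prod
    · intro i _; positivity
    · intro i _
      have hai : (0:ℝ) < a i := by exact_mod_cast ha i
      have := (Nat.lt_floor_add_one (t / n / a i)).le
      rw [div_le_iff₀ hai] at this
      rw [mul_comm]; exact this
  rw [← Finset.mul_prod_erase univ _ (mem_univ i1)]
  rw [← hYc] at hlow
  have hP : 0 ≤ ∏ i ∈ univ.erase i1, (a i : ℝ) := by positivity
  nlinarith [mul_le_mul_of_nonneg_left hcard2 hP]

lemma exists_v {n : ℕ} (hn : 3 ≤ n) (a : Fin n → ℕ) (ha : ∀ i, 0 < a i)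
    (F : ℤ) (s : ℕ) (hs : 1 ≤ s)
    (hF : ({z : Fin n → ℕ | ∑ i, (a i : ℤ) * (z i : ℤ) = F}.ncard) < s)
    (D : ℝ) (hD : 2 * (n:ℝ) ≤ D)
    (hFD : D * ((s : ℝ) * ∏ i, (a i : ℝ)) ^ ((1 : ℝ) / ((n : ℝ) - 1)) ≤ F)
    (ε : ℝ) (hε : 16 * (n:ℝ) ^ 2 / (D * (∏ i, (a i : ℝ)) ^ ((1 : ℝ) / ((n : ℝ) - 1))) ≤ ε) :
    ∃ (v : Fin n → ℤ) (i1 : Fin n) (lam : ℝ), 0 < v i1 ∧ v i1 < a i1 ∧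
      ∀ i, |(v i : ℝ) - lam * a i| ≤ ε * a i := by
  classical
  have hn0 : (3:ℝ) ≤ n := by exact_mod_cast hn
  have hDpos : 0 < D := by linarith
  set i1 : Fin n := ⟨0, by omega⟩ with hi1
  have : NeZero (a i1) := ⟨(ha i1).ne'⟩
  have hP : (1:ℝ) ≤ ∏ i, (a i : ℝ) := by
    have : 1 ≤ ∏ i, a i := Finset.one_le_prod' (fun i _ => ha i)
    exact_mod_cast this
  have hs' : (1:ℝ) ≤ s := by exact_mod_cast hs
  set U := ((s : ℝ) * ∏ i, (a i : ℝ)) ^ ((1 : ℝ) / ((n : ℝ) - 1)) with hU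
  set U0 := (∏ i, (a i : ℝ)) ^ ((1 : ℝ) / ((n : ℝ) - 1)) with hU0
  have hexp : 0 ≤ (1 : ℝ) / ((n : ℝ) - 1) := by
    apply div_nonneg <;> linarith
  have hU0pos : 0 < U0 := by positivity
  have hUU : U0 ≤ U := by
    apply Real.rpow_le_rpow (by positivity) _ hexp
    nlinarith
  have hUpos : 0 < U := by linarith
  have hUpow : U ^ (n - 1) = s * ∏ i, (a i : ℝ) := by
    rw [hU, ← Real.rpow_natCast, ← Real.rpow_mul (by positivity)]
    rw [Nat.cast_sub (by omega)]
    have : (1:ℝ) / ((n:ℝ) - 1) * ((n:ℝ) - (1:ℕ)) = 1 := by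
      have : (n:ℝ) - 1 ≠ 0 := by linarith
      push_cast; field_simp
    rw [this, Real.rpow_one]
  set t := D / (4 * n) * U with ht
  have htpos : 0 < t := by positivity
  set K : Fin n → ℕ := fun i => ⌊t / a i⌋₊ + 1 with hK
  set c : ℝ := 4 * n with hc
  have hcpos : 0 < c := by positivity
  by_contra hcon
  have H : ∀ x : ZMod (a i1), x ≠ 0 → ∃ i, c * (a i1) < K i * |((x * (a i : ZMod (a i1))).valMinAbs : ℝ)| := by
    intro x hx
    by_contra hall
    push Not at hall
    apply hcon
    have hm0 : (0:ℝ) < a i1 := by exact_mod_cast ha i1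
    have hdv : ∀ i, ∃ q : ℤ, (x.val : ℤ) * a i - (x * (a i : ZMod (a i1))).valMinAbs = a i1 * q := by
      intro i
      have : (a i1 : ℤ) ∣ (x.val : ℤ) * a i - (x * (a i : ZMod (a i1))).valMinAbs := by
        rw [← ZMod.intCast_zmod_eq_zero_iff_dvd]
        push_cast
        simp
      obtain ⟨q, hq⟩ := this
      exact ⟨q, hq⟩
    choose v hv using hdv
    have hv1 : v i1 = x.val := by
      have := hv i1
      have hz : x * (a i1 : ZMod (a i1)) = 0 := by simp
      rw [hz, ZMod.valMinAbs_zero, sub_zero] at this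
      have h0 : (a i1 : ℤ) ≠ 0 := by exact_mod_cast (ha i1).ne'
      apply mul_left_cancel₀ h0
      rw [← this]; ring
    refine ⟨v, i1, (x.val : ℝ) / a i1, ?_, ?_, ?_⟩
    · rw [hv1]
      have : x.val ≠ 0 := by rwa [Ne, ZMod.val_eq_zero]
      omega
    · rw [hv1]
      exact_mod_cast ZMod.val_lt x
    · intro i
      have hai : (0:ℝ) < a i := by exact_mod_cast ha i
      have h1 := hall i
      have h2 : ((x.val : ℝ) * a i - ((x * (a i : ZMod (a i1))).valMinAbs : ℝ)) = a i1 * v i := by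
        exact_mod_cast hv i
      have h3 : (v i : ℝ) - (x.val : ℝ) / a i1 * a i = - ((x * (a i : ZMod (a i1))).valMinAbs : ℝ) / a i1 := by
        field_simp
        linarith
      rw [h3, abs_div, abs_neg, abs_of_pos hm0, div_le_iff₀ hm0]
      set w := |((x * (a i : ZMod (a i1))).valMinAbs : ℝ)|
      have hKi : t / a i ≤ K i := by
        rw [hK]; push_cast; exact (Nat.lt_floor_add_one _).le
      have h4 : t / a i * w ≤ c * a i1 := le_trans (by gcongr) h1
      have h5 : w ≤ c * a i1 * a i / t := by
        rw [le_div_iff₀ htpos]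
        rw [div_mul_eq_mul_div, div_le_iff₀ hai] at h4
        linarith
      have h6 : c / t ≤ ε := by
        refine le_trans ?_ hε
        rw [ht, hc]
        have : 4 * (n:ℝ) / (D / (4 * n) * U) = 16 * n^2 / (D * U) := by
          field_simp; ring
        rw [this]
        gcongr
      calc w ≤ c / t * (a i * a i1) := by rw [div_mul_eq_mul_div]; convert h5 using 2; ring
        _ ≤ ε * (a i * a i1) := by gcongr
        _ = _ := by ring
  have hc2 : (1 + 4 / c ^ 2) ^ (Fintype.card (Fin n)) < 2 := by
    rw [Fintype.card_fin]
    have h1 : 1 + 4 / c^2 ≤ Real.exp (4 / c^2) := by linarith [Real.add_one_le_exp (4 / c^2)]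
    calc (1 + 4 / c ^ 2) ^ n ≤ (Real.exp (4 / c^2)) ^ n := by gcongr
      _ = Real.exp (1 / (4 * n)) := by
          rw [← Real.exp_nat_mul]; congr 1; rw [hc]; field_simp
      _ ≤ Real.exp (1/2) := by
          apply Real.exp_le_exp.2
          rw [div_le_div_iff₀ (by positivity) (by norm_num)]; linarith
      _ < 2 := by
          have h := Real.exp_one_lt_d9
          have h2 : Real.exp (1/2) ^ 2 = Real.exp 1 := by rw [← Real.exp_nat_mul]; norm_num
          nlinarith [Real.exp_pos (1/2)]
  have Hz : ∀ r : ZMod (a i1), ∃ ζ : Fin n → ℕ, ∑ i, (a i : ZMod (a i1)) * (ζ i : ZMod (a i1)) = r ∧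
      ∑ i, (a i : ℝ) * ζ i ≤ 2 * n * t := by
    intro r
    obtain ⟨z, hz1, hz2⟩ := flat (fun i => (a i : ZMod (a i1))) K (fun i => Nat.succ_pos _) hcpos hc2 H r
    refine ⟨z, hz2, ?_⟩
    calc ∑ i, (a i : ℝ) * z i ≤ ∑ _i : Fin n, 2 * t := by
          refine Finset.sum_le_sum fun i _ => ?_
          have hai : (0:ℝ) < a i := by exact_mod_cast ha i
          have h1 := hz1 i
          have h2 : z i ≤ 2 * ⌊t / a i⌋₊ := by simpa [hK] using h1
          have h3 : (z i : ℝ) ≤ 2 * ⌊t / a i⌋₊ := by exact_mod_cast h2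
          have h4 : (⌊t / a i⌋₊ : ℝ) ≤ t / a i := Nat.floor_le (by positivity)
          have h5 : (z i : ℝ) ≤ 2 * (t / a i) := by linarith
          calc (a i : ℝ) * z i ≤ a i * (2 * (t / a i)) := by gcongr
            _ = 2 * t := by field_simp
      _ = _ := by simp; ring
  have hb : 2 * n * t + n * U ≤ F := by
    refine le_trans ?_ hFD
    have : 2 * n * t = D / 2 * U := by rw [ht, hc]; field_simp; norm_num
    rw [this]; nlinarith
  have := reps a ha i1 (2 * n * t) (n * U) (by positivity) Hz F hb
  rw [mul_div_cancel_left₀ _ (by positivity), hUpow] at this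
  have hF' : (({z : Fin n → ℕ | ∑ i, (a i : ℤ) * (z i : ℤ) = F}.ncard : ℕ) : ℝ) < s := by exact_mod_cast hF
  nlinarith

lemma exists_u {n : ℕ} (a : Fin n → ℕ) (ha : ∀ i, 0 < a i) (hg : Finset.univ.gcd a = 1)
    (T : Fin n → ℝ) (hT0 : ∀ i, 0 < T i) (hT1 : ∀ i, T i ≤ a i) (hT2 : ∀ i, (a i : ℝ) ≤ 2 * T i)
    (ε : ℝ) (hε : 0 < ε) (hε1 : ε ≤ 1)
    (hv : ∃ (v : Fin n → ℤ) (i1 : Fin n) (lam : ℝ), 0 < v i1 ∧ v i1 < a i1 ∧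
      ∀ i, |(v i : ℝ) - lam * a i| ≤ ε * a i) :
    ∃ (i0 : Fin n) (u : Fin n → ℤ) (k : ℕ) (η : ℝ), 0 < k ∧ u i0 ≠ 0 ∧ η = |(u i0 : ℝ)| / T i0 ∧
      (∀ i, |(u i : ℝ)| ≤ 2 * η * T i) ∧ η ^ 2 ≤ 16 * ε ∧ (∀ i, η ≤ 16 * ε * T i) ∧
      (∀ i, (k : ℝ) ≤ 4 * T i) ∧
      (∀ i, |(a i : ℝ) - a i0 * u i / u i0| ≤ 8 * k * ε * T i / η) ∧
      ∃ l : ℕ, l < k ∧ ∀ i, (k : ℤ) ∣ (a i : ℤ) - l * u i := by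
  obtain ⟨v, i1, lam, hv1, hv2, hv3⟩ := hv
  set σ := Real.sqrt ε with hσ
  have hσ0 : 0 < σ := Real.sqrt_pos.2 hε
  have hσ2 : σ * σ = ε := Real.mul_self_sqrt hε.le
  have hσ1 : σ ≤ 1 := by nlinarith
  have hQ : 0 < ⌊1 / σ⌋₊ := by
    rw [Nat.floor_pos, le_div_iff₀ hσ0]; linarith
  obtain ⟨q, hq1, hq2⟩ := Real.exists_rat_abs_sub_le_and_den_le lam hQ
  set k := q.den with hk
  set j := q.num with hj
  have hk0 : 0 < k := q.den_pos
  have hk0' : (0:ℝ) < k := by exact_mod_cast hk0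
  have hkσ : (k:ℝ) * σ ≤ 1 := by
    have : (k:ℝ) ≤ 1 / σ := le_trans (by exact_mod_cast hq2) (Nat.floor_le (by positivity))
    rwa [le_div_iff₀ hσ0] at this
  have hkj : |(k:ℝ) * lam - j| ≤ σ := by
    have e : (q : ℝ) = j / k := by
      rw [hj, hk]; exact Rat.cast_def q
    have h1 : (k:ℝ) * lam - j = k * (lam - q) := by rw [e]; field_simp
    rw [h1, abs_mul, abs_of_pos hk0']
    have h2 : (1:ℝ) / ((⌊1 / σ⌋₊ + 1) * k) * k ≤ σ := by
      have h3 := (Nat.lt_floor_add_one (1 / σ)).le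
      rw [div_le_iff₀ hσ0] at h3
      rw [one_div_mul_eq_div, div_le_iff₀ (by positivity)]
      nlinarith
    nlinarith
  set u : Fin n → ℤ := fun i => k * v i - j * a i with hu
  have hai : ∀ i, (0:ℝ) < a i := fun i => by exact_mod_cast ha i
  have hcop : IsCoprime (k:ℤ) j := by
    have := q.reduced
    rw [Int.isCoprime_iff_gcd_eq_one, Int.gcd_comm]
    exact this
  have hdvd : ∀ i, u i = 0 → k ∣ a i := by
    intro i hi
    have h1 : (k:ℤ) ∣ j * a i := ⟨v i, by simp only [hu] at hi; linarith⟩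
    exact_mod_cast hcop.dvd_of_dvd_mul_left h1
  have hune : ∃ i, u i ≠ 0 := by
    by_contra hall
    push Not at hall
    have h1 : k ∣ Finset.univ.gcd a := Finset.dvd_gcd fun i _ => hdvd i (hall i)
    rw [hg, Nat.dvd_one] at h1
    have h2 := hall i1
    simp only [hu, h1] at h2
    have h3 : v i1 = j * a i1 := by push_cast at h2; linarith
    have h4 : (0:ℤ) < a i1 := by exact_mod_cast ha i1
    rw [h3] at hv1 hv2
    have h5 : 0 < j := by by_contra h; push Not at h; nlinarith
    nlinarith
  have hub : ∀ i, |(u i : ℝ)| ≤ 2 * σ * a i := by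
    intro i
    have e : (u i : ℝ) = k * (v i - lam * a i) + (k * lam - j) * a i := by
      simp only [hu]; push_cast; ring
    rw [e]
    refine (abs_add_le _ _).trans ?_
    rw [abs_mul, abs_mul, abs_of_pos hk0', abs_of_pos (hai i)]
    have h1 := mul_le_mul_of_nonneg_left (hv3 i) hk0'.le
    have h2 := mul_le_mul_of_nonneg_right hkj (hai i).le
    have h3 : (k:ℝ) * (ε * a i) ≤ σ * a i := by
      rw [← hσ2]
      have := mul_le_mul_of_nonneg_right hkσ (by have := hai i; positivity : 0 ≤ σ * a i)
      linarith
    linarith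
  obtain ⟨i0, -, hi0⟩ := Finset.exists_max_image univ (fun i => |(u i : ℝ)| / a i) ⟨i1, mem_univ _⟩
  have hu0 : u i0 ≠ 0 := by
    obtain ⟨i, hi⟩ := hune
    intro h0
    have := hi0 i (mem_univ _)
    rw [h0] at this
    have h2 : 0 < |(u i : ℝ)| / a i := by
      have : (u i : ℝ) ≠ 0 := by exact_mod_cast hi
      have := hai i
      positivity
    simp at this
    linarith
  have hu0' : (0:ℝ) < |(u i0 : ℝ)| := by
    have : (u i0 : ℝ) ≠ 0 := by exact_mod_cast hu0
    positivity
  have hcl : ∀ i, |(a i : ℝ) * u i0 - a i0 * u i| ≤ 2 * k * ε * (a i * a i0) := by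
    intro i
    have e : (a i : ℝ) * u i0 - a i0 * u i = k * (a i * (v i0 - lam * a i0)) - k * (a i0 * (v i - lam * a i)) := by
      simp only [hu]; push_cast; ring
    rw [e]
    refine (abs_sub _ _).trans ?_
    rw [abs_mul, abs_mul, abs_mul, abs_mul, abs_of_pos hk0', abs_of_pos (hai i), abs_of_pos (hai i0)]
    have h1 := mul_le_mul_of_nonneg_left (hv3 i0) (mul_pos hk0' (hai i)).le
    have h2 := mul_le_mul_of_nonneg_left (hv3 i) (mul_pos hk0' (hai i0)).le
    nlinarith
  set η := |(u i0 : ℝ)| / T i0 with hη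
  have hη0 : 0 < η := by have := hT0 i0; positivity
  have hηT : |(u i0 : ℝ)| = η * T i0 := by rw [hη]; have := hT0 i0; field_simp
  have hηa : |(u i0 : ℝ)| / a i0 ≤ η := by
    rw [hη]; have := hT0 i0; have := hT1 i0; gcongr
  have hη4 : η ≤ 4 * σ := by
    rw [hη, div_le_iff₀ (hT0 i0)]
    have := hub i0
    have := hT2 i0
    nlinarith
  have hk4 : ∀ i, (k : ℝ) ≤ 4 * T i ∧ η ≤ 16 * ε * T i := by
    intro i
    have t0 := hT0 i
    have t2 := hT2 i
    by_cases hi : u i = 0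
    · have h1 : k ≤ a i := Nat.le_of_dvd (ha i) (hdvd i hi)
      have h2 : (k:ℝ) ≤ a i := by exact_mod_cast h1
      refine ⟨by linarith, ?_⟩
      have h3 := hcl i
      rw [hi, Int.cast_zero, mul_zero, sub_zero, abs_mul, abs_of_pos (hai i)] at h3
      have h4 : |(u i0 : ℝ)| ≤ 2 * k * ε * a i0 := by
        have := hai i
        apply le_of_mul_le_mul_left _ this
        linarith
      rw [hη, div_le_iff₀ (hT0 i0)]
      calc |(u i0 : ℝ)| ≤ 2 * k * ε * a i0 := h4
        _ ≤ 2 * (2 * T i) * ε * (2 * T i0) := by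
            gcongr
            · linarith
            · exact hT2 i0
        _ ≤ 16 * ε * T i * T i0 := by
            have := hT0 i0
            have : 0 < ε * T i * T i0 := by positivity
            nlinarith
    · have h1 : (1:ℝ) ≤ |(u i : ℝ)| := by
        have := Int.one_le_abs hi
        exact_mod_cast this
      have h2 := hub i
      have h3 : 1 ≤ 4 * σ * T i := by nlinarith
      constructor
      · nlinarith
      · rw [← hσ2]; nlinarith
  refine ⟨i0, u, k, η, hk0, hu0, rfl, ?_, ?_, fun i => (hk4 i).2, fun i => (hk4 i).1, ?_, ?_⟩
  · intro i
    have h1 := hi0 i (mem_univ _)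
    have h2 := h1.trans hηa
    rw [div_le_iff₀ (hai i)] at h2
    have := hT2 i
    nlinarith
  · rw [← hσ2]; nlinarith
  · intro i
    have hne : (u i0 : ℝ) ≠ 0 := by exact_mod_cast hu0
    have e : (a i : ℝ) - a i0 * u i / u i0 = (a i * u i0 - a i0 * u i) / u i0 := by field_simp
    rw [e, abs_div, div_le_div_iff₀ hu0' hη0, hηT]
    have h1 := hcl i
    have h2 : 2 * k * ε * (a i * a i0) ≤ 2 * k * ε * ((2 * T i) * (2 * T i0)) := by
      have := hT2 i
      have := hT2 i0
      have := hT0 i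
      gcongr
    have h3 := mul_le_mul_of_nonneg_right (h1.trans h2) hη0.le
    linarith
  · obtain ⟨x, y, hxy⟩ := hcop
    have hkz : (k:ℤ) ≠ 0 := by exact_mod_cast hk0.ne'
    have hnn : 0 ≤ (-y) % (k:ℤ) := Int.emod_nonneg _ hkz
    refine ⟨((-y) % (k:ℤ)).toNat, ?_, ?_⟩
    · have := Int.emod_lt_of_pos (-y) (by exact_mod_cast hk0 : (0:ℤ) < k)
      omega
    · intro i
      rw [Int.toNat_of_nonneg hnn]
      have h1 : (-y) % (k:ℤ) = -y - k * ((-y) / k) := Int.emod_def _ _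
      rw [h1]
      refine ⟨x * a i + y * v i + ((-y) / k) * u i, ?_⟩
      simp only [hu]
      linear_combination (-(a i : ℤ)) * hxy

lemma class_count (S : Finset ℕ) (k : ℕ) (hk : 0 < k) (L : ℝ) (hL : 0 ≤ L)
    (h1 : ∀ x ∈ S, ∀ y ∈ S, (k : ℤ) ∣ (x : ℤ) - y) (h2 : ∀ x ∈ S, ∀ y ∈ S, (x : ℝ) - y ≤ L) :
    (S.card : ℝ) ≤ L / k + 1 := by
  have hk' : (0:ℝ) < k := by exact_mod_cast hk
  rcases S.eq_empty_or_nonempty with rfl | hS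
  · simp; positivity
  set s0 := S.min' hS with hs0
  have hs0m : s0 ∈ S := S.min'_mem hS
  have hc : S.card ≤ (range (⌊L / k⌋₊ + 1)).card := by
    apply Finset.card_le_card_of_injOn (fun x => (x - s0) / k)
    · intro x hx
      have hx' : s0 ≤ x := S.min'_le x hx
      have h3 := h2 x hx s0 hs0m
      rw [Finset.coe_range, Set.mem_Iio, Nat.lt_succ_iff]
      apply Nat.le_floor
      refine Nat.cast_div_le.trans ?_
      rw [Nat.cast_sub hx']
      gcongr
    · intro x hx y hy hxy
      have hx' : s0 ≤ x := S.min'_le x hx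
      have hy' : s0 ≤ y := S.min'_le y hy
      have d1 : k ∣ x - s0 := by
        have := h1 x hx s0 hs0m
        rw [← Nat.cast_sub hx'] at this
        exact_mod_cast this
      have d2 : k ∣ y - s0 := by
        have := h1 y hy s0 hs0m
        rw [← Nat.cast_sub hy'] at this
        exact_mod_cast this
      have : x - s0 = y - s0 := by
        rw [← Nat.div_mul_cancel d1, ← Nat.div_mul_cancel d2]
        simp only at hxy
        rw [hxy]
      omega
  rw [Finset.card_range] at hc
  calc (S.card : ℝ) ≤ ((⌊L / k⌋₊ + 1 : ℕ) : ℝ) := by exact_mod_cast hc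
    _ ≤ L / k + 1 := by
      push_cast
      have := Nat.floor_le (by positivity : 0 ≤ L / k)
      linarith

lemma card_le_prod_image {n : ℕ} (S : Finset (Fin n → ℕ)) :
    S.card ≤ ∏ i, (S.image (fun a => a i)).card := by
  rw [← Fintype.card_piFinset]
  apply Finset.card_le_card
  intro a ha
  rw [Fintype.mem_piFinset]
  intro i
  exact Finset.mem_image_of_mem (fun a => a i) ha

lemma fiber_count {n : ℕ} (T : Fin n → ℝ) (hT0 : ∀ i, 0 < T i) (ε η : ℝ) (hε : 0 < ε) (hη : 0 < η)
    (i0 : Fin n) (u : Fin n → ℤ) (k l : ℕ) (hk : 0 < k)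
    (h3 : ∀ i, η ≤ 16 * ε * T i) (h4 : ∀ i, (k : ℝ) ≤ 4 * T i)
    (S : Finset (Fin n → ℕ))
    (hS : ∀ a ∈ S, (∀ i, T i ≤ a i ∧ (a i : ℝ) ≤ 2 * T i) ∧
      (∀ i, |(a i : ℝ) - a i0 * u i / u i0| ≤ 8 * k * ε * T i / η) ∧
      ∀ i, (k : ℤ) ∣ (a i : ℤ) - l * u i) :
    (S.card : ℝ) ≤ 5 * T i0 / k * ∏ i ∈ univ.erase i0, (32 * T i * min (ε / η) (1 / k)) := by
  classical
  have hk' : (0:ℝ) < k := by exact_mod_cast hk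
  have hdv : ∀ a ∈ S, ∀ b ∈ S, ∀ i, (k:ℤ) ∣ (a i : ℤ) - b i := by
    intro a ha b hb i
    have := dvd_sub ((hS a ha).2.2 i) ((hS b hb).2.2 i)
    simpa using this
  set B := ∏ i ∈ univ.erase i0, (32 * T i * min (ε / η) (1 / (k:ℝ))) with hB
  have hmin : 0 < min (ε / η) (1 / (k:ℝ)) := by positivity
  have hB0 : 0 ≤ B := Finset.prod_nonneg fun i _ => by have := hT0 i; positivity
  have hfib : ∀ y ∈ S.image (fun a => a i0), ((S.filter (fun a => a i0 = y)).card : ℝ) ≤ B := by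
    intro y _
    set S' := S.filter (fun a => a i0 = y) with hS'
    have h1 : (S'.card : ℝ) ≤ ∏ i, ((S'.image (fun a => a i)).card : ℝ) := by
      exact_mod_cast card_le_prod_image S'
    rw [← Finset.mul_prod_erase univ _ (mem_univ i0)] at h1
    have h2 : ((S'.image (fun a => a i0)).card : ℝ) ≤ 1 := by
      have : (S'.image (fun a => a i0)).card ≤ 1 := by
        rw [Finset.card_le_one]
        intro p hp r hr
        obtain ⟨a, ha, rfl⟩ := Finset.mem_image.1 hp
        obtain ⟨b, hb, rfl⟩ := Finset.mem_image.1 hr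
        rw [(Finset.mem_filter.1 ha).2, (Finset.mem_filter.1 hb).2]
      exact_mod_cast this
    have h5 : ∏ i ∈ univ.erase i0, ((S'.image (fun a => a i)).card : ℝ) ≤ B := by
      apply Finset.prod_le_prod
      · intro i _; positivity
      · intro i _
        have t0 := hT0 i
        have hc := class_count (S'.image (fun a => a i)) k hk
          (min (16 * k * ε * T i / η) (T i)) (by positivity) ?_ ?_
        · have e1 : min (16 * k * ε * T i / η) (T i) / k ≤ 16 * (T i * min (ε / η) (1 / (k:ℝ))) := by
            rw [div_le_iff₀ hk']
            rcases le_total (ε / η) (1 / (k:ℝ)) with h | h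
            · rw [min_eq_left h]
              refine (min_le_left _ _).trans (le_of_eq ?_)
              ring
            · rw [min_eq_right h]
              refine (min_le_right _ _).trans ?_
              field_simp
              norm_num
          have e2 : 1 ≤ 16 * (T i * min (ε / η) (1 / (k:ℝ))) := by
            rcases le_total (ε / η) (1 / (k:ℝ)) with h | h
            · rw [min_eq_left h]
              have := h3 i
              rw [show 16 * (T i * (ε / η)) = 16 * ε * T i / η by ring, le_div_iff₀ hη]
              linarith
            · rw [min_eq_right h]
              have := h4 i
              rw [show 16 * (T i * (1 / (k:ℝ))) = 16 * T i / k by ring, le_div_iff₀ hk']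
              linarith
          linarith
        · intro p hp r hr
          obtain ⟨a, ha, rfl⟩ := Finset.mem_image.1 hp
          obtain ⟨b, hb, rfl⟩ := Finset.mem_image.1 hr
          exact hdv a (Finset.mem_filter.1 ha).1 b (Finset.mem_filter.1 hb).1 i
        · intro p hp r hr
          obtain ⟨a, ha, rfl⟩ := Finset.mem_image.1 hp
          obtain ⟨b, hb, rfl⟩ := Finset.mem_image.1 hr
          obtain ⟨ha1, ha2⟩ := Finset.mem_filter.1 ha
          obtain ⟨hb1, hb2⟩ := Finset.mem_filter.1 hb
          apply le_min
          · have c1 := (hS a ha1).2.1 i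
            have c2 := (hS b hb1).2.1 i
            rw [ha2] at c1
            rw [hb2] at c2
            rw [abs_le] at c1 c2
            have : 16 * k * ε * T i / η = 8 * k * ε * T i / η + 8 * k * ε * T i / η := by ring
            rw [this]
            linarith [c1.2, c2.1]
          · have c1 := (hS a ha1).1 i
            have c2 := (hS b hb1).1 i
            linarith [c1.2, c2.1]
    calc (S'.card : ℝ) ≤ _ := h1
      _ ≤ 1 * B := by
          apply mul_le_mul h2 h5 _ (by norm_num)
          exact Finset.prod_nonneg fun i _ => by positivity
      _ = B := one_mul _
  have himg : ((S.image (fun a => a i0)).card : ℝ) ≤ 5 * T i0 / k := by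
    have t0 := hT0 i0
    have hc := class_count (S.image (fun a => a i0)) k hk (T i0) t0.le ?_ ?_
    · have : 1 ≤ 4 * T i0 / k := by rw [le_div_iff₀ hk']; linarith [h4 i0]
      have e : 5 * T i0 / k = T i0 / k + 4 * T i0 / k := by ring
      linarith
    · intro p hp r hr
      obtain ⟨a, ha, rfl⟩ := Finset.mem_image.1 hp
      obtain ⟨b, hb, rfl⟩ := Finset.mem_image.1 hr
      exact hdv a ha b hb i0
    · intro p hp r hr
      obtain ⟨a, ha, rfl⟩ := Finset.mem_image.1 hp
      obtain ⟨b, hb, rfl⟩ := Finset.mem_image.1 hr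
      linarith [((hS a ha).1 i0).2, ((hS b hb).1 i0).1]
  have hsum := Finset.card_eq_sum_card_image (fun a : Fin n → ℕ => a i0) S
  have hsum' : (S.card : ℝ) = ∑ y ∈ S.image (fun a => a i0), ((S.filter (fun a => a i0 = y)).card : ℝ) := by
    exact_mod_cast hsum
  rw [hsum']
  calc _ ≤ ∑ y ∈ S.image (fun a => a i0), B := Finset.sum_le_sum hfib
    _ = ((S.image (fun a => a i0)).card : ℝ) * B := by rw [Finset.sum_const, nsmul_eq_mul]
    _ ≤ _ := by gcongr

lemma sum_min (ρ : ℝ) (hρ : 0 < ρ) (q M : ℕ) :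
    ∑ k ∈ Icc 1 M, (min ρ (1 / (k:ℝ))) ^ (q + 2) ≤ 4 * ρ ^ (q + 1) := by
  have h1 : ∀ k ∈ Icc 1 M, (min ρ (1 / (k:ℝ))) ^ (q + 2) ≤
      ρ ^ q * (4 * (1 / (1 / ρ + ((k - 1 : ℕ) : ℝ)) - 1 / (1 / ρ + (((k - 1 : ℕ) : ℝ) + 1)))) := by
    intro k hk
    have hk1 := (Finset.mem_Icc.1 hk).1
    have hk0 : (1:ℝ) ≤ k := by exact_mod_cast hk1
    have e : ((k - 1 : ℕ) : ℝ) = k - 1 := by rw [Nat.cast_sub hk1]; simp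
    rw [e, pow_add]
    set A := 1 / ρ with hA
    have hA0 : 0 < A := by positivity
    have hm0 : 0 < min ρ (1 / (k:ℝ)) := by positivity
    have hm : min ρ (1 / (k:ℝ)) ≤ 2 / (A + k) := by
      rw [le_div_iff₀ (by positivity)]
      have m1 : min ρ (1 / (k:ℝ)) * A ≤ 1 := by
        calc _ ≤ ρ * A := by gcongr; exact min_le_left _ _
          _ = 1 := by rw [hA]; field_simp
      have m2 : min ρ (1 / (k:ℝ)) * k ≤ 1 := by
        calc _ ≤ 1 / (k:ℝ) * k := by gcongr; exact min_le_right _ _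
          _ = 1 := by field_simp
      linarith
    have h2 : (min ρ (1 / (k:ℝ))) ^ 2 ≤ 4 * (1 / (A + (k - 1)) - 1 / (A + (k - 1 + 1))) := by
      calc _ ≤ (2 / (A + k)) ^ 2 := by gcongr
        _ ≤ _ := by
          have p1 : 0 < A + (k - 1 : ℝ) := by linarith
          have p2 : 0 < A + (k - 1 + 1 : ℝ) := by linarith
          rw [div_sub_div _ _ p1.ne' p2.ne', div_pow, mul_div_assoc', div_le_div_iff₀ (by positivity) (by positivity)]
          nlinarith
    have h3 : (min ρ (1 / (k:ℝ))) ^ q ≤ ρ ^ q := by gcongr; exact min_le_left _ _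
    exact mul_le_mul h3 h2 (by positivity) (by positivity)
  refine (Finset.sum_le_sum h1).trans ?_
  rw [← Finset.mul_sum, ← Finset.mul_sum]
  have h2 : ∑ k ∈ Icc 1 M, (1 / (1 / ρ + ((k - 1 : ℕ) : ℝ)) - 1 / (1 / ρ + (((k - 1 : ℕ) : ℝ) + 1))) ≤ ρ := by
    have e : ∀ M : ℕ, ∑ k ∈ Icc 1 M, (1 / (1 / ρ + ((k - 1 : ℕ) : ℝ)) - 1 / (1 / ρ + (((k - 1 : ℕ) : ℝ) + 1))) = ρ - 1 / (1 / ρ + M) := by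
      intro M
      induction M with
      | zero => simp
      | succ M ih =>
        rw [Finset.sum_Icc_succ_top (by omega), ih]
        simp
    rw [e]
    have : 0 ≤ 1 / (1 / ρ + (M:ℝ)) := by positivity
    linarith
  calc ρ ^ q * (4 * _) ≤ ρ ^ q * (4 * ρ) := by gcongr
    _ = _ := by ring

lemma x_bound (q : ℕ) (T : Fin (q+3) → ℝ) (hT0 : ∀ i, 1 ≤ T i) (N : ℝ) (hTN : ∀ i, T i ≤ N)
    (ε η R : ℝ) (hε : 0 < ε) (hη : 0 < η) (hηN : 1 ≤ η * N) (i0 m0 : Fin (q+3))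
    (hηR : η ≤ R) (hR1 : R ^ 2 ≤ 16 * ε) (hR2 : R ≤ 16 * ε * T m0) :
    (∏ i ∈ univ.erase i0, (4 * η * T i + 1)) * (ε / η) ^ (q + 1) * (2 * R * T i0) ≤
      160 * 5 ^ (q + 1) * (ε ^ (q + 2) * N ^ (q + 2) * T m0) := by
  classical
  have hR0 : 0 < R := by linarith
  have hN0 : 0 < N := by have := hTN m0; have := hT0 m0; linarith
  have t0 : ∀ i, 0 < T i := fun i => by have := hT0 i; linarith
  have hfac : ∀ i, 4 * η * T i + 1 ≤ 5 * η * N := by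
    intro i
    have := mul_le_mul_of_nonneg_left (hTN i) hη.le
    linarith
  by_cases h : m0 = i0
  · subst h
    have h1 : ∏ i ∈ univ.erase m0, (4 * η * T i + 1) ≤ (5 * η * N) ^ (q + 2) := by
      calc _ ≤ ∏ i ∈ univ.erase m0, (5 * η * N) := by
            apply Finset.prod_le_prod
            · intro i _; have := t0 i; positivity
            · intro i _; exact hfac i
        _ = _ := by rw [Finset.prod_const, Finset.card_erase_of_mem (mem_univ _)]; simp
    have tm := t0 m0
    calc _ ≤ (5 * η * N) ^ (q + 2) * (ε / η) ^ (q + 1) * (2 * R * T m0) := by gcongr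
      _ = 10 * 5 ^ (q + 1) * (η * R) * (ε ^ (q + 1) * N ^ (q + 2) * T m0) := by
          rw [div_pow]; field_simp; ring
      _ ≤ 10 * 5 ^ (q + 1) * (16 * ε) * (ε ^ (q + 1) * N ^ (q + 2) * T m0) := by
          have : η * R ≤ 16 * ε := by nlinarith
          gcongr
      _ = _ := by ring
  · have hm : m0 ∈ univ.erase i0 := Finset.mem_erase.2 ⟨h, mem_univ _⟩
    have h1 : ∏ i ∈ univ.erase i0, (4 * η * T i + 1) ≤ (4 * R * T m0 + 1) * (5 * η * N) ^ (q + 1) := by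
      rw [← Finset.mul_prod_erase _ _ hm]
      have tm := t0 m0
      apply mul_le_mul
      · gcongr
      · calc _ ≤ ∏ i ∈ (univ.erase i0).erase m0, (5 * η * N) := by
              apply Finset.prod_le_prod
              · intro i _; have := t0 i; positivity
              · intro i _; exact hfac i
          _ = _ := by
              rw [Finset.prod_const, Finset.card_erase_of_mem hm, Finset.card_erase_of_mem (mem_univ _)]; simp
      · exact Finset.prod_nonneg fun i _ => by have := t0 i; positivity
      · positivity
    have tm := t0 m0
    have ti := t0 i0
    calc _ ≤ ((4 * R * T m0 + 1) * (5 * η * N) ^ (q + 1)) * (ε / η) ^ (q + 1) * (2 * R * N) := by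
            gcongr
            exact hTN i0
      _ = 2 * 5 ^ (q + 1) * (4 * R ^ 2 * T m0 + R) * (ε ^ (q + 1) * N ^ (q + 2)) := by
          rw [div_pow]; field_simp; ring
      _ ≤ 2 * 5 ^ (q + 1) * (4 * (16 * ε) * T m0 + 16 * ε * T m0) * (ε ^ (q + 1) * N ^ (q + 2)) := by
          gcongr
      _ = _ := by ring

lemma box_i0 (q : ℕ) (T : Fin (q+3) → ℝ) (hT0 : ∀ i, 1 ≤ T i) (N : ℝ) (hTN : ∀ i, T i ≤ N)
    (ε : ℝ) (hε : 0 < ε) (i0 m0 : Fin (q+3)) (A : Finset (Fin (q+3) → ℕ))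
    (hbox : ∀ a ∈ A, ∀ i, T i ≤ a i ∧ (a i : ℝ) ≤ 2 * T i)
    (hA : ∀ a ∈ A, ∃ (u : Fin (q+3) → ℤ) (k : ℕ) (η : ℝ), 0 < k ∧ u i0 ≠ 0 ∧ η = |(u i0 : ℝ)| / T i0 ∧
      (∀ i, |(u i : ℝ)| ≤ 2 * η * T i) ∧ η ^ 2 ≤ 16 * ε ∧ (∀ i, η ≤ 16 * ε * T i) ∧
      (∀ i, (k : ℝ) ≤ 4 * T i) ∧
      (∀ i, |(a i : ℝ) - a i0 * u i / u i0| ≤ 8 * k * ε * T i / η) ∧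
      ∃ l : ℕ, l < k ∧ ∀ i, (k : ℤ) ∣ (a i : ℤ) - l * u i) :
    (A.card : ℝ) ≤ 20 * 32 ^ (q + 2) * (160 * 5 ^ (q + 1)) *
      ((∏ i, T i) * ε ^ (q + 2) * (N ^ (q + 2) * T m0)) := by
  classical
  have t0 : ∀ i, 0 < T i := fun i => by have := hT0 i; linarith
  have hN0 : 0 < N := by have := hTN m0; have := hT0 m0; linarith
  set R := min (4 * Real.sqrt ε) (16 * ε * T m0) with hR
  have hR0 : 0 < R := by have := t0 m0; positivity
  have hR1 : R ^ 2 ≤ 16 * ε := by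
    calc R ^ 2 ≤ (4 * Real.sqrt ε) ^ 2 := by gcongr; exact min_le_left _ _
      _ = 16 * ε := by rw [mul_pow, Real.sq_sqrt hε.le]; norm_num
  have hR2 : R ≤ 16 * ε * T m0 := min_le_right _ _
  set et : ℤ → ℝ := fun x => |(x:ℝ)| / T i0 with het
  set M := ⌊R * T i0⌋₊ with hM
  set X := (Icc (-(M:ℤ)) M).erase 0 with hX
  set Km := ⌊4 * T i0⌋₊ with hKm
  set U : ℤ → Finset (Fin (q+3) → ℤ) := fun x => Fintype.piFinset
    (fun i => if i = i0 then {x} else Icc (-(⌊2 * et x * T i⌋₊ : ℤ)) ⌊2 * et x * T i⌋₊) with hU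
  set P : ℤ → ℕ → (Fin (q+3) → ℤ) → ℕ → Finset (Fin (q+3) → ℕ) := fun x k u l =>
    A.filter (fun a => u i0 = x ∧ (∀ i, et x ≤ 16 * ε * T i) ∧ (∀ i, (k : ℝ) ≤ 4 * T i) ∧
      (∀ i, |(a i : ℝ) - a i0 * u i / u i0| ≤ 8 * k * ε * T i / et x) ∧
      ∀ i, (k : ℤ) ∣ (a i : ℤ) - l * u i) with hP
  have het0 : ∀ x ∈ X, 0 < et x := by
    intro x hx
    have h1 : (x:ℝ) ≠ 0 := by exact_mod_cast (Finset.mem_erase.1 hx).1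
    have := t0 i0
    simp only [het]; positivity
  have hcov : A ⊆ X.biUnion fun x => (Icc 1 Km).biUnion fun k => (U x).biUnion fun u =>
      (range k).biUnion fun l => P x k u l := by
    intro a ha
    obtain ⟨u, k, η, hk, hu0, hη, h1, h2, h3, h4, h5, l, hl, h6⟩ := hA a ha
    have hηe : et (u i0) = η := by rw [hη]
    have hη0 : 0 ≤ η := by rw [hη]; have := t0 i0; positivity
    have hηR : η ≤ R := by
      apply le_min _ (h3 m0)
      have : η ≤ Real.sqrt (16 * ε) := Real.le_sqrt_of_sq_le h2
      rw [Real.sqrt_mul (by norm_num), show Real.sqrt 16 = 4 by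
        rw [show (16:ℝ) = 4 ^ 2 by norm_num]; exact Real.sqrt_sq (by norm_num)] at this
      exact this
    have key : ∀ (z : ℤ) (B : ℝ), |(z:ℝ)| ≤ B → z ∈ Icc (-(⌊B⌋₊ : ℤ)) ⌊B⌋₊ := by
      intro z B hz
      have : z.natAbs ≤ ⌊B⌋₊ := by
        apply Nat.le_floor
        rw [Nat.cast_natAbs, Int.cast_abs]; exact hz
      rw [Finset.mem_Icc]; omega
    simp only [Finset.mem_biUnion]
    refine ⟨u i0, ?_, k, ?_, u, ?_, l, Finset.mem_range.2 hl, ?_⟩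
    · refine Finset.mem_erase.2 ⟨hu0, key _ _ ?_⟩
      have := t0 i0
      rw [← div_le_iff₀ this, ← hη]; exact hηR
    · exact Finset.mem_Icc.2 ⟨hk, Nat.le_floor (h4 i0)⟩
    · refine Fintype.mem_piFinset.2 fun i => ?_
      split_ifs with hi
      · rw [hi]; exact Finset.mem_singleton_self _
      · apply key
        rw [hηe]; exact h1 i
    · refine Finset.mem_filter.2 ⟨ha, rfl, ?_, h4, ?_, h6⟩
      · rw [hηe]; exact h3
      · rw [hηe]; exact h5
  have hPc : ∀ x ∈ X, ∀ k ∈ Icc 1 Km, ∀ u ∈ U x, ∀ l ∈ range k, ((P x k u l).card : ℝ) ≤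
      5 * T i0 / k * ∏ i ∈ univ.erase i0, (32 * T i * min (ε / et x) (1 / k)) := by
    intro x hx k hk u _ l _
    have hk1 := (Finset.mem_Icc.1 hk).1
    have := het0 x hx
    rcases (P x k u l).eq_empty_or_nonempty with h | ⟨a, ha⟩
    · rw [h]; simp
      have := t0 i0
      have : 0 ≤ ∏ i ∈ univ.erase i0, (32 * T i * min (ε / et x) ((k:ℝ)⁻¹)) :=
        Finset.prod_nonneg fun i _ => by have := t0 i; positivity
      positivity
    · have ha' := (Finset.mem_filter.1 ha).2
      apply fiber_count T t0 ε (et x) hε (het0 x hx) i0 u k l hk1 ha'.2.1 ha'.2.2.1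
      intro b hb
      have hb' := Finset.mem_filter.1 hb
      exact ⟨hbox b hb'.1, hb'.2.2.2.2.1, hb'.2.2.2.2.2⟩
  have hUc : ∀ x ∈ X, ((U x).card : ℝ) ≤ ∏ i ∈ univ.erase i0, (4 * et x * T i + 1) := by
    intro x hx
    have e0 := het0 x hx
    rw [hU, Fintype.card_piFinset, ← Finset.mul_prod_erase univ _ (mem_univ i0)]
    simp only [if_true, Finset.card_singleton, one_mul]
    push_cast
    apply Finset.prod_le_prod
    · intro i _; positivity
    · intro i hi
      rw [if_neg (Finset.ne_of_mem_erase hi), Int.card_Icc]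
      have := Nat.floor_le (by have := t0 i; positivity : 0 ≤ 2 * et x * T i)
      have e : ((⌊2 * et x * T i⌋₊ : ℤ) + 1 - -(⌊2 * et x * T i⌋₊ : ℤ)).toNat = 2 * ⌊2 * et x * T i⌋₊ + 1 := by omega
      rw [e]; push_cast
      linarith
  have hXc : (X.card : ℝ) ≤ 2 * R * T i0 := by
    rw [hX, Finset.card_erase_of_mem (by simp), Int.card_Icc]
    have e : ((M:ℤ) + 1 - -(M:ℤ)).toNat - 1 = 2 * M := by omega
    rw [e]; push_cast
    have := Nat.floor_le (by have := t0 i0; positivity : 0 ≤ R * T i0)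
    rw [← hM] at this
    linarith
  set Q := ∏ i, T i with hQ
  have hQ0 : 0 < Q := Finset.prod_pos fun i _ => t0 i
  have hprod : ∀ (β : ℝ), T i0 * ∏ i ∈ univ.erase i0, (32 * T i * β) = 32 ^ (q+2) * Q * β ^ (q+2) := by
    intro β
    rw [hQ, ← Finset.mul_prod_erase univ T (mem_univ i0), Finset.prod_mul_distrib, Finset.prod_mul_distrib,
      Finset.prod_const, Finset.prod_const, Finset.card_erase_of_mem (mem_univ _)]
    simp only [Finset.card_univ, Fintype.card_fin]
    simp only [Nat.add_sub_cancel, show q + 3 - 1 = q + 2 by omega]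
    ring
  have hnat : A.card ≤ ∑ x ∈ X, ∑ k ∈ Icc 1 Km, ∑ u ∈ U x, ∑ l ∈ range k, (P x k u l).card := by
    refine (Finset.card_le_card hcov).trans ?_
    refine Finset.card_biUnion_le.trans (Finset.sum_le_sum fun x _ => ?_)
    refine Finset.card_biUnion_le.trans (Finset.sum_le_sum fun k _ => ?_)
    refine Finset.card_biUnion_le.trans (Finset.sum_le_sum fun u _ => ?_)
    exact Finset.card_biUnion_le
  set Z := 160 * 5 ^ (q + 1) * (ε ^ (q + 2) * N ^ (q + 2) * T m0) with hZ
  have hx : ∀ x ∈ X, (∑ k ∈ Icc 1 Km, ∑ u ∈ U x, ∑ l ∈ range k, ((P x k u l).card : ℝ)) * (2 * R * T i0) ≤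
      20 * 32 ^ (q+2) * Q * Z := by
    intro x hx
    have e0 := het0 x hx
    have ti := t0 i0
    set W := ∏ i ∈ univ.erase i0, (4 * et x * T i + 1) with hW
    have hW0 : 0 ≤ W := Finset.prod_nonneg fun i _ => by have := t0 i; positivity
    have s1 : ∀ k ∈ Icc 1 Km, ∑ u ∈ U x, ∑ l ∈ range k, ((P x k u l).card : ℝ) ≤
        W * (5 * (32 ^ (q+2) * Q * (min (ε / et x) (1 / (k:ℝ))) ^ (q+2))) := by
      intro k hk
      have hk1 : (0:ℝ) < k := by exact_mod_cast (Finset.mem_Icc.1 hk).1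
      rw [← hprod]
      set Y := ∏ i ∈ univ.erase i0, (32 * T i * min (ε / et x) (1 / (k:ℝ))) with hY
      have hY0 : 0 ≤ Y := Finset.prod_nonneg fun i _ => by have := t0 i; positivity
      calc _ ≤ ∑ u ∈ U x, ∑ l ∈ range k, 5 * T i0 / k * Y :=
            Finset.sum_le_sum fun u hu => Finset.sum_le_sum fun l hl => hPc x hx k hk u hu l hl
        _ = (U x).card * (5 * (T i0 * Y)) := by
            simp only [Finset.sum_const, nsmul_eq_mul, Finset.card_range]
            field_simp
        _ ≤ _ := by
            have := hUc x hx
            gcongr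
    have s2 : ∑ k ∈ Icc 1 Km, ∑ u ∈ U x, ∑ l ∈ range k, ((P x k u l).card : ℝ) ≤
        20 * 32 ^ (q+2) * Q * (W * (ε / et x) ^ (q+1)) := by
      refine (Finset.sum_le_sum s1).trans ?_
      rw [← Finset.mul_sum, ← Finset.mul_sum, ← Finset.mul_sum]
      have := sum_min (ε / et x) (by positivity) q Km
      calc _ ≤ W * (5 * (32 ^ (q + 2) * Q * (4 * (ε / et x) ^ (q + 1)))) := by gcongr
        _ = _ := by ring
    have hxm := Finset.mem_Icc.1 (Finset.mem_erase.1 hx).2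
    have hx1 : (1:ℝ) ≤ |(x:ℝ)| := by
      have := Int.one_le_abs (Finset.mem_erase.1 hx).1
      exact_mod_cast this
    have hxR : et x ≤ R := by
      simp only [het]
      rw [div_le_iff₀ ti]
      have h1 : |x| ≤ (M:ℤ) := abs_le.2 hxm
      have h2 : |(x:ℝ)| ≤ (M:ℝ) := by exact_mod_cast h1
      exact h2.trans (Nat.floor_le (by positivity))
    have hxN : 1 ≤ et x * N := by
      simp only [het]
      rw [div_mul_eq_mul_div, le_div_iff₀ ti]
      have := hTN i0
      nlinarith
    have s3 := x_bound q T hT0 N hTN ε (et x) R hε e0 hxN i0 m0 hxR hR1 hR2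
    calc _ ≤ 20 * 32 ^ (q+2) * Q * (W * (ε / et x) ^ (q+1)) * (2 * R * T i0) := by gcongr
      _ = 20 * 32 ^ (q+2) * Q * (W * (ε / et x) ^ (q+1) * (2 * R * T i0)) := by ring
      _ ≤ _ := by gcongr
  have hR' : 0 < 2 * R * T i0 := by have := t0 i0; positivity
  have hfin : (A.card : ℝ) ≤ 20 * 32 ^ (q+2) * Q * Z := by
    have h1 : (A.card : ℝ) ≤ ∑ x ∈ X, ∑ k ∈ Icc 1 Km, ∑ u ∈ U x, ∑ l ∈ range k, ((P x k u l).card : ℝ) := by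
      exact_mod_cast hnat
    have h2 : ∑ x ∈ X, ∑ k ∈ Icc 1 Km, ∑ u ∈ U x, ∑ l ∈ range k, ((P x k u l).card : ℝ) ≤
        ∑ x ∈ X, 20 * 32 ^ (q+2) * Q * Z / (2 * R * T i0) :=
      Finset.sum_le_sum fun x h => by rw [le_div_iff₀ hR']; exact hx x h
    rw [Finset.sum_const, nsmul_eq_mul] at h2
    have hZ0 : 0 ≤ Z := by have := t0 m0; positivity
    calc _ ≤ _ := h1.trans h2
      _ ≤ (2 * R * T i0) * (20 * 32 ^ (q+2) * Q * Z / (2 * R * T i0)) := by gcongr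
      _ = _ := by rw [mul_comm, div_mul_cancel₀ _ hR'.ne']
  refine hfin.trans (le_of_eq ?_)
  rw [hZ]; ring


noncomputable def Cq (q : ℕ) : ℝ := 20 * 32 ^ (q + 2) * (160 * 5 ^ (q + 1))

lemma box_all (q : ℕ) (T : Fin (q+3) → ℝ) (hT0 : ∀ i, 1 ≤ T i) (N : ℝ) (hTN : ∀ i, T i ≤ N)
    (ε : ℝ) (hε : 0 < ε) (m0 : Fin (q+3)) (A : Finset (Fin (q+3) → ℕ))
    (hbox : ∀ a ∈ A, ∀ i, T i ≤ a i ∧ (a i : ℝ) ≤ 2 * T i)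
    (hA : ∀ a ∈ A, ∃ (i0 : Fin (q+3)) (u : Fin (q+3) → ℤ) (k : ℕ) (η : ℝ), 0 < k ∧ u i0 ≠ 0 ∧
      η = |(u i0 : ℝ)| / T i0 ∧
      (∀ i, |(u i : ℝ)| ≤ 2 * η * T i) ∧ η ^ 2 ≤ 16 * ε ∧ (∀ i, η ≤ 16 * ε * T i) ∧
      (∀ i, (k : ℝ) ≤ 4 * T i) ∧
      (∀ i, |(a i : ℝ) - a i0 * u i / u i0| ≤ 8 * k * ε * T i / η) ∧
      ∃ l : ℕ, l < k ∧ ∀ i, (k : ℤ) ∣ (a i : ℤ) - l * u i) :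
    (A.card : ℝ) ≤ (q + 3) * (Cq q * ((∏ i, T i) * ε ^ (q + 2) * (N ^ (q + 2) * T m0))) := by
  classical
  choose! f hf using hA
  have h1 : A.card = ∑ i0 : Fin (q+3), (A.filter (fun a => f a = i0)).card :=
    Finset.card_eq_sum_card_fiberwise (fun x _ => by simp)
  have h2 : ∀ i0 : Fin (q+3), ((A.filter (fun a => f a = i0)).card : ℝ) ≤
      Cq q * ((∏ i, T i) * ε ^ (q + 2) * (N ^ (q + 2) * T m0)) := by
    intro i0
    refine box_i0 q T hT0 N hTN ε hε i0 m0 _ (fun a ha => hbox a (Finset.mem_filter.1 ha).1) ?_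
    intro a ha
    obtain ⟨ha1, rfl⟩ := Finset.mem_filter.1 ha
    exact hf a ha1
  rw [h1]
  push_cast
  calc _ ≤ ∑ i0 : Fin (q+3), Cq q * ((∏ i, T i) * ε ^ (q + 2) * (N ^ (q + 2) * T m0)) :=
        Finset.sum_le_sum fun i _ => h2 i
    _ = _ := by simp

def Bad (q : ℕ) (s : ℕ) (D : ℝ) (a : Fin (q+3) → ℕ) : Prop :=
  ∃ F : ℤ, ({z : Fin (q+3) → ℕ | ∑ i, (a i : ℤ) * (z i : ℤ) = F}.ncard) < s ∧
    D * ((s:ℝ) * ∏ i, (a i:ℝ)) ^ ((1:ℝ)/(((q+3 : ℕ):ℝ)-1)) ≤ F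

lemma box_bad (q : ℕ) (s : ℕ) (hs : 1 ≤ s) (D : ℝ) (hD : 16 * ((q:ℝ)+3)^2 ≤ D) (N : ℝ)
    (e : Fin (q+3) → ℕ) (he : ∀ i, (2:ℝ)^(e i) ≤ N) (r : ℝ) (hr : 1 ≤ r) (hr2 : r ^ (q+3) = 2)
    (A : Finset (Fin (q+3) → ℕ))
    (hbox : ∀ a ∈ A, ∀ i, (2:ℝ)^(e i) ≤ a i ∧ (a i : ℝ) ≤ 2 * 2^(e i))
    (hA : ∀ a ∈ A, Finset.univ.gcd a = 1 ∧ Bad q s D a) :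
    (A.card : ℝ) ≤ (q + 3) * (Cq q * (16 * ((q:ℝ)+3)^2) ^ (q+2) * (D⁻¹)^(q+2) * N^(q+2) * ∏ i, r ^ (e i)) := by
  classical
  set T : Fin (q+3) → ℝ := fun i => (2:ℝ)^(e i) with hT
  have hT1 : ∀ i, 1 ≤ T i := fun i => one_le_pow₀ (by norm_num)
  have t0 : ∀ i, 0 < T i := fun i => by have := hT1 i; linarith
  set P := ∏ i, T i with hP
  have hP1 : 1 ≤ P := by
    rw [hP]
    calc (1:ℝ) = ∏ i : Fin (q+3), (1:ℝ) := by simp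
      _ ≤ _ := Finset.prod_le_prod (fun _ _ => by norm_num) (fun i _ => hT1 i)
  have hP0 : 0 < P := by linarith
  have hN0 : 0 < N := by have := he 0; have := t0 0; linarith
  set β : ℝ := (1:ℝ)/(((q+3 : ℕ):ℝ)-1) with hβ
  have hβ1 : ((q+3 : ℕ):ℝ)-1 = ((q+2:ℕ):ℝ) := by push_cast; ring
  have hβ0 : 0 ≤ β := by rw [hβ, hβ1]; positivity
  have hPβ : 1 ≤ P ^ β := Real.one_le_rpow hP1 hβ0
  have hPβn : (P ^ β) ^ (q+2) = P := by
    rw [← Real.rpow_natCast, ← Real.rpow_mul hP0.le, hβ, hβ1, one_div_mul_cancel (by positivity), Real.rpow_one]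
  set c : ℝ := 16 * ((q:ℝ)+3)^2 with hc
  have hc0 : 0 < c := by positivity
  have hD0 : 0 < D := by linarith
  set ε := c / (D * P ^ β) with hε
  have hε0 : 0 < ε := by positivity
  have hε1 : ε ≤ 1 := by
    rw [hε, div_le_one (by positivity)]
    nlinarith
  obtain ⟨m0, -, hm0⟩ := Finset.exists_min_image (Finset.univ : Finset (Fin (q+3))) e ⟨0, Finset.mem_univ _⟩
  have hmT : T m0 ≤ ∏ i, r ^ (e i) := by
    calc T m0 = ∏ i : Fin (q+3), r ^ (e m0) := by
          simp only [hT, Finset.prod_const, Finset.card_univ, Fintype.card_fin]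
          rw [← hr2, ← pow_mul, ← pow_mul, mul_comm]
      _ ≤ _ := Finset.prod_le_prod (fun _ _ => by positivity)
          (fun i _ => pow_le_pow_right₀ hr (hm0 i (Finset.mem_univ _)))
  have key := box_all q T hT1 N he ε hε0 m0 A hbox (by
    intro a ha
    have hapos : ∀ i, 0 < a i := fun i => by
      have := (hbox a ha i).1
      have := t0 i
      have h3 : (0:ℝ) < a i := by linarith
      exact_mod_cast h3
    obtain ⟨hg, F, hF, hFD⟩ := hA a ha
    refine exists_u a hapos hg T t0 (fun i => (hbox a ha i).1) (fun i => (hbox a ha i).2) ε hε0 hε1 ?_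
    refine exists_v (by omega) a hapos F s hs hF D ?_ hFD ε ?_
    · refine le_trans ?_ hD
      push_cast
      rw [hc]
      nlinarith [(Nat.cast_nonneg q : (0:ℝ) ≤ q)]
    · rw [hε]
      have : ((q+3:ℕ):ℝ) = (q:ℝ)+3 := by push_cast; ring
      have hcc : 16 * ((q+3:ℕ):ℝ)^2 = c := by rw [hc, this]
      rw [hcc]
      have h4 : P ≤ ∏ i, (a i : ℝ) := Finset.prod_le_prod (fun i _ => (t0 i).le) (fun i _ => (hbox a ha i).1)
      gcongr)
  refine key.trans ?_
  have h5 : P * ε ^ (q+2) = c ^ (q+2) * (D⁻¹)^(q+2) := by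
    rw [hε, div_pow, mul_pow D, hPβn, inv_pow]
    field_simp
  have hC0 : 0 < Cq q := by unfold Cq; positivity
  calc _ = ((q:ℝ) + 3) * (Cq q * c ^ (q+2) * (D⁻¹)^(q+2) * N^(q+2) * T m0) := by rw [h5]; ring
    _ ≤ _ := by gcongr

lemma total_bad (q : ℕ) : ∃ K : ℝ, 0 < K ∧ ∀ (s : ℕ) (hs : 1 ≤ s) (D : ℝ) (hD : 16 * ((q:ℝ)+3)^2 ≤ D)
    (N : ℕ) (hN : 0 < N) (A : Finset (Fin (q+3) → ℕ))
    (hA : ∀ a ∈ A, (∀ i, 0 < a i ∧ a i ≤ N) ∧ Finset.univ.gcd a = 1 ∧ Bad q s D a),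
    (A.card : ℝ) ≤ K * (D⁻¹)^(q+2) * (N:ℝ)^(q+3) := by
  classical
  set r : ℝ := (2:ℝ) ^ ((1:ℝ)/((q+3:ℕ):ℝ)) with hr
  have hr2 : r ^ (q+3) = 2 := by
    rw [hr, ← Real.rpow_natCast, ← Real.rpow_mul (by norm_num), one_div_mul_cancel (by positivity), Real.rpow_one]
  have hr1 : 1 < r := by
    rw [hr]; exact Real.one_lt_rpow (by norm_num) (by positivity)
  have hC0 : 0 < Cq q := by unfold Cq; positivity
  have hr0 : 0 < r - 1 := by linarith
  refine ⟨(q + 3) * (Cq q * (16 * ((q:ℝ)+3)^2) ^ (q+2)) * (2 / (r-1)^(q+3)), by positivity, ?_⟩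
  intro s hs D hD N hN A hA
  have hD0 : 0 < D := lt_of_lt_of_le (by positivity) hD
  set Lg := Nat.log 2 N with hLg
  have h1 : A.card = ∑ e ∈ Fintype.piFinset (fun _ : Fin (q+3) => range (Lg+1)),
      (A.filter (fun a => (fun i => Nat.log 2 (a i)) = e)).card :=
    Finset.card_eq_sum_card_fiberwise (fun a ha => by
      simp only [Finset.mem_coe, Fintype.mem_piFinset, Finset.mem_range]
      intro i
      exact Nat.lt_succ_of_le (Nat.log_mono_right ((hA a ha).1 i).2))
  set W : ℝ := (q + 3) * (Cq q * (16 * ((q:ℝ)+3)^2) ^ (q+2) * (D⁻¹)^(q+2) * (N:ℝ)^(q+2)) with hW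
  have h2 : ∀ e ∈ Fintype.piFinset (fun _ : Fin (q+3) => range (Lg+1)),
      ((A.filter (fun a => (fun i => Nat.log 2 (a i)) = e)).card : ℝ) ≤ W * ∏ i, r ^ (e i) := by
    intro e he
    rw [Fintype.mem_piFinset] at he
    refine (box_bad q s hs D hD N e ?_ r hr1.le hr2 _ ?_ ?_).trans (le_of_eq (by rw [hW]; ring))
    · intro i
      have : 2 ^ (e i) ≤ N := (Nat.pow_le_pow_right (by norm_num) (Nat.lt_succ_iff.1 (Finset.mem_range.1 (he i)))).trans
        (Nat.pow_log_le_self 2 hN.ne')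
      exact_mod_cast this
    · intro a ha i
      obtain ⟨ha1, rfl⟩ := Finset.mem_filter.1 ha
      have h3 := Nat.pow_log_le_self 2 (((hA a ha1).1 i).1.ne')
      have h4 := (Nat.lt_pow_succ_log_self (b := 2) (by norm_num) (a i)).le
      rw [pow_succ, mul_comm] at h4
      exact ⟨by exact_mod_cast h3, by exact_mod_cast h4⟩
    · intro a ha
      exact (hA a (Finset.mem_filter.1 ha).1).2
  have hsum : ∑ e ∈ Fintype.piFinset (fun _ : Fin (q+3) => range (Lg+1)), ∏ i, r ^ (e i)
      = (∑ j ∈ range (Lg+1), r ^ j) ^ (q+3) := by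
    rw [← Finset.prod_univ_sum (fun _ : Fin (q+3) => range (Lg+1)) (fun _ j => r ^ j)]
    simp
  have hgeo : (∑ j ∈ range (Lg+1), r ^ j) ^ (q+3) ≤ 2 * N / (r-1)^(q+3) := by
    have hg : ∑ j ∈ range (Lg+1), r ^ j ≤ r^(Lg+1) / (r-1) := by
      rw [geom_sum_eq hr1.ne']
      gcongr; linarith
    calc _ ≤ (r^(Lg+1) / (r-1))^(q+3) := by
          refine pow_le_pow_left₀ (Finset.sum_nonneg fun i _ => by positivity) hg _
      _ = (2^(Lg) * 2) / (r-1)^(q+3) := by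
          rw [div_pow, ← pow_mul, mul_comm, pow_mul, hr2, pow_succ]
      _ ≤ _ := by
          have : (2:ℝ)^Lg ≤ N := by exact_mod_cast Nat.pow_log_le_self 2 hN.ne'
          gcongr ?_ / _
          linarith
  have hW0 : 0 ≤ W := by positivity
  rw [h1]
  push_cast
  calc _ ≤ ∑ e ∈ Fintype.piFinset (fun _ : Fin (q+3) => range (Lg+1)), W * ∏ i, r ^ (e i) :=
        Finset.sum_le_sum h2
    _ = W * (∑ j ∈ range (Lg+1), r ^ j) ^ (q+3) := by rw [← Finset.mul_sum, hsum]
    _ ≤ W * (2 * N / (r-1)^(q+3)) := by gcongr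
    _ = _ := by rw [hW]; ring

lemma sum_recip (m : ℕ) (N : ℕ) : ∑ d ∈ Icc 2 N, (1:ℝ) / (d:ℝ)^(m+3) ≤ 1/2 := by
  have h : ∀ N : ℕ, 1 ≤ N → ∑ d ∈ Icc 2 N, (1:ℝ) / (d:ℝ)^(m+3) ≤ 1/2 - 1/(2*N) := by
    intro N hN
    induction N, hN using Nat.le_induction with
    | base => norm_num
    | succ k hk ih =>
      rw [Finset.sum_Icc_succ_top (by omega)]
      have hk' : (1:ℝ) ≤ k := by exact_mod_cast hk
      have h1 : (1:ℝ) / ((k+1:ℕ):ℝ)^(m+3) ≤ 1/(2*k) - 1/(2*((k+1:ℕ):ℝ)) := by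
        push_cast
        calc (1:ℝ) / ((k:ℝ)+1)^(m+3) ≤ 1 / ((k:ℝ)+1)^3 := by
              apply one_div_le_one_div_of_le (by positivity)
              exact pow_le_pow_right₀ (by linarith) (by omega)
          _ ≤ 1 / (2 * k * (k+1)) := by
              apply one_div_le_one_div_of_le (by positivity)
              have h0 : (0:ℝ) ≤ (k:ℝ)^3 + k^2 + k + 1 := by positivity
              nlinarith
          _ = _ := by field_simp; ring
      linarith
  rcases Nat.eq_zero_or_pos N with rfl | hN
  · norm_num
  · refine (h N hN).trans ?_
    have : (0:ℝ) ≤ 1/(2*N) := by positivity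
    linarith

lemma card_G (q N : ℕ) (hN : 0 < N) (G : Finset (Fin (q+3) → ℕ))
    (hG : ∀ a, (∀ i, 0 < a i ∧ a i ≤ N) → Finset.univ.gcd a = 1 → a ∈ G) :
    (N:ℝ)^(q+3) ≤ 2 * G.card := by
  classical
  have hsub : Fintype.piFinset (fun _ : Fin (q+3) => Icc 1 N) ⊆
      G ∪ (Icc 2 N).biUnion (fun d => Fintype.piFinset (fun _ : Fin (q+3) => (Icc 1 (N/d)).image (fun j => d * j))) := by
    intro a ha
    simp only [Fintype.mem_piFinset, Finset.mem_Icc] at ha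
    rw [Finset.mem_union]
    by_cases hg : Finset.univ.gcd a = 1
    · exact Or.inl (hG a (fun i => ⟨by have := (ha i).1; omega, (ha i).2⟩) hg)
    · right
      rw [Finset.mem_biUnion]
      have hdv : ∀ i, Finset.univ.gcd a ∣ a i := fun i => Finset.gcd_dvd (Finset.mem_univ i)
      have hle : Finset.univ.gcd a ≤ a 0 := Nat.le_of_dvd (by have := (ha 0).1; omega) (hdv 0)
      have hne : Finset.univ.gcd a ≠ 0 := by
        intro h0
        have := hdv 0
        rw [h0, zero_dvd_iff] at this
        have := (ha 0).1
        omega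
      have := (ha 0).2
      refine ⟨Finset.univ.gcd a, Finset.mem_Icc.2 ⟨by omega, by omega⟩, ?_⟩
      rw [Fintype.mem_piFinset]
      intro i
      obtain ⟨j, hj⟩ := hdv i
      refine Finset.mem_image.2 ⟨j, Finset.mem_Icc.2 ⟨?_, ?_⟩, hj.symm⟩
      · rcases Nat.eq_zero_or_pos j with rfl | h
        · have := (ha i).1; simp at hj; omega
        · exact h
      · rw [Nat.le_div_iff_mul_le (by omega), mul_comm, ← hj]
        exact (ha i).2
  have h1 := (Finset.card_le_card hsub).trans (Finset.card_union_le _ _)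
  have h2 := h1.trans (Nat.add_le_add_left Finset.card_biUnion_le _)
  have h3 : ((Fintype.piFinset (fun _ : Fin (q+3) => Icc 1 N)).card : ℝ) = (N:ℝ)^(q+3) := by
    simp
  have h4 : ∀ d ∈ Icc 2 N, ((Fintype.piFinset (fun _ : Fin (q+3) => (Icc 1 (N/d)).image (fun j => d * j))).card : ℝ)
      ≤ (N:ℝ)^(q+3) * (1 / (d:ℝ)^(q+3)) := by
    intro d hd
    have hd2 := (Finset.mem_Icc.1 hd).1
    rw [Fintype.card_piFinset]
    simp only [Finset.prod_const, Finset.card_univ, Fintype.card_fin]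
    push_cast
    have h5 : (((Icc 1 (N/d)).image (fun j => d * j)).card : ℝ) ≤ (N:ℝ)/d := by
      refine le_trans ?_ (Nat.cast_div_le (α := ℝ) (m := N) (n := d))
      have : ((Icc 1 (N/d)).image (fun j => d * j)).card ≤ N / d := Finset.card_image_le.trans (by simp)
      exact_mod_cast this
    calc _ ≤ ((N:ℝ)/d)^(q+3) := by gcongr
      _ = _ := by rw [div_pow]; ring
  have h6 : (N:ℝ)^(q+3) ≤ G.card + ∑ d ∈ Icc 2 N, (N:ℝ)^(q+3) * (1 / (d:ℝ)^(q+3)) := by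
    rw [← h3]
    refine (Nat.cast_le.2 h2).trans ?_
    push_cast
    have := Finset.sum_le_sum h4
    rw [h3]
    linarith
  rw [← Finset.mul_sum] at h6
  have h7 := mul_le_mul_of_nonneg_left (sum_recip q N) (by positivity : (0:ℝ) ≤ (N:ℝ)^(q+3))
  linarith

end SFrob

/-- **Tail bound for the normalized s-Frobenius number** (Corollary 1 i) in
Aliev–Fukshansky–Henk). For `n ≥ 3` there is a constant `C = C_n > 0` such that for
every `s ≥ 1`, `T ≥ 1` and `D > 0`, the number of vectors `a ∈ G(T)` (primitive
positive integer vectors with `max aᵢ ≤ T`) whose normalized `s`-Frobenius number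
`X_s(a) = F_s(a)/(s·a₁⋯aₙ)^(1/(n-1))` is at least `D` is at most
`C · D^{-(n-1)} · #G(T)`. -/
theorem sFrobenius_tail_bound {n : ℕ} (hn : 3 ≤ n) :
    ∃ C : ℝ, 0 < C ∧
      ∀ F : (Fin n → ℕ) → ℕ → ℤ,
        (∀ (a : Fin n → ℕ) (s : ℕ), (∀ i, 0 < a i) → Finset.univ.gcd a = 1 → 1 ≤ s →
          IsGreatest
            {b : ℤ | {z : Fin n → ℕ | ∑ i, (a i : ℤ) * (z i : ℤ) = b}.ncard < s}
            (F a s)) →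
      ∀ s : ℕ, 1 ≤ s → ∀ T : ℝ, 1 ≤ T → ∀ D : ℝ, 0 < D →
      ∀ G : Finset (Fin n → ℕ),
        (∀ a, a ∈ G ↔ ((∀ i, 0 < a i) ∧ Finset.univ.gcd a = 1 ∧ ∀ i, (a i : ℝ) ≤ T)) →
        (({a | a ∈ G ∧ D ≤ (F a s : ℝ) /
              ((s : ℝ) * ∏ i, (a i : ℝ)) ^ ((1 : ℝ) / ((n : ℝ) - 1))} :
            Set (Fin n → ℕ)).ncard : ℝ)
          ≤ C * D ^ (-((n : ℝ) - 1)) * (G.card : ℝ) := by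
  classical
  obtain ⟨q, rfl⟩ : ∃ q, n = q + 3 := ⟨n - 3, by omega⟩
  obtain ⟨K, hK, hKb⟩ := SFrob.total_bad q
  set c : ℝ := 16 * ((q:ℝ)+3)^2 with hc
  have hc0 : 0 < c := by positivity
  refine ⟨2 * K + c ^ (q+2), by positivity, ?_⟩
  intro F hF s hs T hT D hD G hG
  have hpow : D ^ (-(((q+3:ℕ) : ℝ) - 1)) = (D⁻¹)^(q+2) := by
    rw [show -(((q+3:ℕ) : ℝ) - 1) = -((q+2:ℕ):ℝ) by push_cast; ring, Real.rpow_neg hD.le,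
      Real.rpow_natCast, inv_pow]
  rw [hpow]
  set A : Finset (Fin (q+3) → ℕ) := G.filter (fun a => D ≤ (F a s : ℝ) /
    ((s : ℝ) * ∏ i, (a i : ℝ)) ^ ((1 : ℝ) / (((q+3:ℕ) : ℝ) - 1))) with hAdef
  have hset : ({a | a ∈ G ∧ D ≤ (F a s : ℝ) /
      ((s : ℝ) * ∏ i, (a i : ℝ)) ^ ((1 : ℝ) / (((q+3:ℕ) : ℝ) - 1))} : Set (Fin (q+3) → ℕ)) = (A : Set _) := by
    ext a; simp [hAdef]
  rw [hset, Set.ncard_coe_finset]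
  have hDi : 0 < D⁻¹ := by positivity
  rcases le_or_gt c D with hcD | hcD
  · have hN : 0 < ⌊T⌋₊ := Nat.floor_pos.2 hT
    have h1 := hKb s hs D hcD ⌊T⌋₊ hN A (by
      intro a ha
      obtain ⟨haG, haD⟩ := Finset.mem_filter.1 ha
      obtain ⟨hp, hg, hle⟩ := (hG a).1 haG
      refine ⟨fun i => ⟨hp i, Nat.le_floor (hle i)⟩, hg, F a s, (hF a s hp hg hs).1, ?_⟩
      have hpr : (0:ℝ) < ∏ i, (a i : ℝ) := Finset.prod_pos fun i _ => by exact_mod_cast hp i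
      have hs0 : (0:ℝ) < s := by exact_mod_cast hs
      rwa [le_div_iff₀ (by positivity)] at haD)
    have h2 := SFrob.card_G q ⌊T⌋₊ hN G (fun a ha hg => (hG a).2 ⟨fun i => (ha i).1, hg, fun i =>
      (Nat.cast_le.2 (ha i).2).trans (Nat.floor_le (by linarith))⟩)
    calc (A.card : ℝ) ≤ K * (D⁻¹)^(q+2) * (⌊T⌋₊:ℝ)^(q+3) := h1
      _ ≤ K * (D⁻¹)^(q+2) * (2 * G.card) := by gcongr
      _ = (2 * K) * (D⁻¹)^(q+2) * G.card := by ring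
      _ ≤ _ := by gcongr; linarith [pow_pos hc0 (q+2)]
  · have h1 : (A.card : ℝ) ≤ G.card := by exact_mod_cast Finset.card_filter_le _ _
    have h2 : 1 ≤ c ^ (q+2) * (D⁻¹)^(q+2) := by
      rw [← mul_pow]
      refine one_le_pow₀ ?_
      rw [← div_eq_mul_inv, le_div_iff₀ hD]
      linarith
    calc (A.card : ℝ) ≤ 1 * G.card := by linarith
      _ ≤ (c ^ (q+2) * (D⁻¹)^(q+2)) * G.card := by gcongr
      _ ≤ _ := by gcongr; linarith
end

section
/- Let n ≥ 3 be an integer. There exist a constant c'_n > 0 and a threshold T_0 > 0, both depending only on n, such that for every integer s ≥ 1 and every real T ≥ T_0, the average of the normalized s-Frobenius number over G(T) satisfies (1/#G(T)) · Σ_{a ∈ G(T)} X_s(a) ≥ c'_n, where G(T) = {a ∈ ℤ^n_{>0} : gcd(a_1,…,a_n) = 1, max_i a_i ≤ T} and X_s(a) = F_s(a)/(s·a_1·…·a_n)^{1/(n-1)}. -/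
lemma fbKey {n : ℕ} (hn : 3 ≤ n) (a : Fin n → ℕ) (ha : ∀ i, 0 < a i) (s : ℕ) (F : ℤ)
    (hs : 1 ≤ s)
    (hF : IsGreatest
            {b : ℤ | {z : Fin n → ℕ | ∑ i, (a i : ℤ) * (z i : ℤ) = b}.ncard < s} F)
    (B : ℕ) (hB : ∀ i, a i ≤ B) (h : 2 ^ (n+1) * B ^ (n-1) ≤ s * ∏ i, a i) :
    (B : ℤ) ≤ 2 * F := by
  by_contra hlt
  push Not at hlt
  set S : Finset (Fin n → ℕ) := Fintype.piFinset fun i => Finset.range (B / a i + 1) with hS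
  have hcard : S.card = ∏ i, (B / a i + 1) := by simp [hS]
  have hfib : ∀ b ∈ Finset.Ioc F (B:ℤ),
      s ≤ (S.filter (fun z => ∑ i, (a i : ℤ) * (z i : ℤ) = b)).card := by
    intro b hb
    rw [Finset.mem_Ioc] at hb
    have h1 : s ≤ {z : Fin n → ℕ | ∑ i, (a i : ℤ) * (z i : ℤ) = b}.ncard := by
      by_contra hc
      push Not at hc
      have := hF.2 hc
      omega
    refine h1.trans ?_
    rw [← Set.ncard_coe_finset]
    apply Set.ncard_le_ncard _ (Finset.finite_toSet _)
    intro z hz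
    simp only [Set.mem_ofPred_eq] at hz
    simp only [Finset.coe_filter, Set.mem_ofPred_eq, hS, Fintype.mem_piFinset, Finset.mem_range]
    refine ⟨fun i => ?_, hz⟩
    rw [Nat.lt_succ_iff, Nat.le_div_iff_mul_le (ha i)]
    have h2 : (a i : ℤ) * (z i : ℤ) ≤ ∑ i, (a i : ℤ) * (z i : ℤ) :=
      Finset.single_le_sum (f := fun i => (a i : ℤ) * (z i : ℤ))
        (fun j _ => by positivity) (Finset.mem_univ i)
    have h3 : (a i : ℤ) * (z i : ℤ) ≤ B := by omega
    rw [mul_comm]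
    exact_mod_cast h3
  have hsum : (Finset.Ioc F (B:ℤ)).card * s ≤ S.card := by
    calc (Finset.Ioc F (B:ℤ)).card * s = ∑ b ∈ Finset.Ioc F (B:ℤ), s := by simp
      _ ≤ ∑ b ∈ Finset.Ioc F (B:ℤ),
          (S.filter (fun z => ∑ i, (a i : ℤ) * (z i : ℤ) = b)).card := Finset.sum_le_sum hfib
      _ = ((Finset.Ioc F (B:ℤ)).biUnion
          (fun b => S.filter (fun z => ∑ i, (a i : ℤ) * (z i : ℤ) = b))).card := by
          rw [Finset.card_biUnion]
          intro b _ b' _ hbb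
          rw [Function.onFun, Finset.disjoint_left]
          intro z h1 h2
          exact hbb ((Finset.mem_filter.1 h1).2.symm.trans (Finset.mem_filter.1 h2).2)
      _ ≤ S.card := by
          apply Finset.card_le_card
          intro z hz
          obtain ⟨b, _, hb⟩ := Finset.mem_biUnion.1 hz
          exact (Finset.mem_filter.1 hb).1
  rw [Int.card_Ioc, hcard] at hsum
  set m := ((B:ℤ) - F).toNat with hm
  have hmB : B < 2 * m := by omega
  have hprod : (∏ i, (B / a i + 1)) * ∏ i, a i ≤ (2 * B) ^ n := by
    rw [← Finset.prod_mul_distrib]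
    calc _ ≤ ∏ i : Fin n, (2 * B) := by
          apply Finset.prod_le_prod' 
          intro i _
          have := Nat.div_mul_le_self B (a i)
          have := hB i
          nlinarith
      _ = _ := by simp
  have hBpos : 0 < B := lt_of_lt_of_le (ha ⟨0, by omega⟩) (hB _)
  have hP : 0 < s * ∏ i, a i := Nat.mul_pos hs (Finset.prod_pos fun i _ => ha i)
  obtain ⟨k, rfl⟩ : ∃ k, n = k + 1 := ⟨n - 1, by omega⟩
  simp only [Nat.add_sub_cancel] at h
  have e1 : m * (s * ∏ i, a i) ≤ (2 * B) ^ (k+1) := by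
    calc m * (s * ∏ i, a i) = (m * s) * ∏ i, a i := by ring
      _ ≤ _ := Nat.mul_le_mul_right _ hsum
      _ ≤ _ := hprod
  have e2 : B * (s * ∏ i, a i) < 2 * m * (s * ∏ i, a i) := Nat.mul_lt_mul_of_pos_right hmB hP
  have e3 : B * (2 ^ (k+1+1) * B ^ k) ≤ B * (s * ∏ i, a i) := Nat.mul_le_mul_left _ h
  have e4 : B * (2 ^ (k+1+1) * B ^ k) = 2 * (2 * B) ^ (k+1) := by rw [mul_pow]; ring
  nlinarith

lemma fbSumInv (N : ℕ) : ∑ d ∈ Finset.Icc 2 N, (1:ℝ) / (d:ℝ)^3 ≤ 1/2 := by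
  have : ∀ M : ℕ, ∑ d ∈ Finset.Ico 2 (M+2), (1:ℝ) / (d:ℝ)^3 ≤ 1/2 * (1 - 1 / ((M:ℝ)+1)) := by
    intro M
    induction M with
    | zero => simp
    | succ M ih =>
      rw [show M + 1 + 2 = (M + 2) + 1 by ring, Finset.sum_Ico_succ_top (by omega)]
      have h0 : (0:ℝ) ≤ M := by positivity
      have : (1:ℝ) / ((M+2:ℕ):ℝ)^3 ≤ 1/2 * (1/((M:ℝ)+1) - 1/((M:ℝ)+2)) := by
        push_cast
        rw [div_sub_div _ _ (by positivity) (by positivity), div_mul_div_comm,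
          div_le_div_iff₀ (by positivity) (by positivity)]
        nlinarith [mul_nonneg h0 h0, mul_nonneg (mul_nonneg h0 h0) h0]
      push_cast at *
      rw [show (M:ℝ)+1+1 = M+2 by ring]
      linarith
  have h2 := this N
  have h3 : ∑ d ∈ Finset.Icc 2 N, (1:ℝ) / (d:ℝ)^3 ≤ ∑ d ∈ Finset.Ico 2 (N+2), (1:ℝ) / (d:ℝ)^3 := by
    apply Finset.sum_le_sum_of_subset_of_nonneg
    · intro d; simp; omega
    · intros; positivity
  have : (0:ℝ) ≤ 1 / ((N:ℝ)+1) := by positivity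
  linarith

lemma fbPrim {n : ℕ} (hn : 3 ≤ n) (N : ℕ) :
    (N:ℝ)^n / 2 ≤ (((Fintype.piFinset fun _ : Fin n => Finset.Icc 1 N).filter
      (fun a => Finset.univ.gcd a = 1)).card : ℝ) := by
  set Q := Fintype.piFinset fun _ : Fin n => Finset.Icc 1 N with hQ
  have hQc : Q.card = N ^ n := by simp [hQ]
  have hsplit := Finset.card_filter_add_card_filter_not (s := Q) (fun a => Finset.univ.gcd a = 1)
  have hsub : Q.filter (fun a => ¬ Finset.univ.gcd a = 1) ⊆ (Finset.Icc 2 N).biUnion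
      (fun d => Fintype.piFinset fun _ : Fin n => (Finset.Ioc 0 N).filter (d ∣ ·)) := by
    intro a ha
    simp only [hQ, Finset.mem_filter, Fintype.mem_piFinset, Finset.mem_Icc] at ha
    simp only [Finset.mem_biUnion, Fintype.mem_piFinset, Finset.mem_filter, Finset.mem_Ioc,
      Finset.mem_Icc]
    have hd : ∀ i, Finset.univ.gcd a ∣ a i := fun i => Finset.gcd_dvd (Finset.mem_univ i)
    have i0 : Fin n := ⟨0, by omega⟩
    have h0 : 0 < Finset.univ.gcd a := Nat.pos_of_dvd_of_pos (hd i0) (ha.1 i0).1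
    have h1 := Nat.le_of_dvd (ha.1 i0).1 (hd i0)
    have h2 := (ha.1 i0).2
    refine ⟨Finset.univ.gcd a, ⟨by have := ha.2; omega, by omega⟩, fun i => ⟨⟨(ha.1 i).1, (ha.1 i).2⟩, hd i⟩⟩
  have hc : (Q.filter (fun a => ¬ Finset.univ.gcd a = 1)).card ≤ ∑ d ∈ Finset.Icc 2 N, (N / d)^n := by
    refine (Finset.card_le_card hsub).trans (Finset.card_biUnion_le.trans (le_of_eq ?_))
    apply Finset.sum_congr rfl
    intro d _
    simp [Nat.Ioc_filter_dvd_card_eq_div]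
  have hr : ((Q.filter (fun a => ¬ Finset.univ.gcd a = 1)).card : ℝ) ≤ (N:ℝ)^n / 2 := by
    calc ((Q.filter (fun a => ¬ Finset.univ.gcd a = 1)).card : ℝ)
        ≤ ∑ d ∈ Finset.Icc 2 N, ((N / d : ℕ) : ℝ)^n := by exact_mod_cast hc
      _ ≤ ∑ d ∈ Finset.Icc 2 N, (N:ℝ)^n * (1 / (d:ℝ)^3) := by
          apply Finset.sum_le_sum
          intro d hd
          have hd2 : (1:ℝ) ≤ d := by
            have := (Finset.mem_Icc.1 hd).1
            exact_mod_cast (by omega : 1 ≤ d)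
          calc ((N / d : ℕ) : ℝ)^n ≤ ((N:ℝ) / d)^n := by
                gcongr
                exact Nat.cast_div_le
            _ = (N:ℝ)^n * (1 / (d:ℝ)^n) := by rw [div_pow]; ring
            _ ≤ _ := by
                gcongr
      _ = (N:ℝ)^n * ∑ d ∈ Finset.Icc 2 N, (1 / (d:ℝ)^3) := by rw [Finset.mul_sum]
      _ ≤ (N:ℝ)^n * (1/2) := by
          gcongr
          exact fbSumInv N
      _ = _ := by ring
  have : ((Q.filter (fun a => Finset.univ.gcd a = 1)).card : ℝ) +
      ((Q.filter (fun a => ¬ Finset.univ.gcd a = 1)).card : ℝ) = (N:ℝ)^n := by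
    rw [hQc] at hsplit
    exact_mod_cast hsplit
  linarith

/-- vectors in the box with some coordinate at most `K` -/
lemma fbSmall {n : ℕ} (hn : 1 ≤ n) (N K : ℕ) :
    ((Fintype.piFinset fun _ : Fin n => Finset.Icc 1 N).filter
      (fun a => ∃ i, a i ≤ K)).card ≤ n * (K * N^(n-1)) := by
  have hsub : (Fintype.piFinset fun _ : Fin n => Finset.Icc 1 N).filter
      (fun a => ∃ i, a i ≤ K) ⊆ (Finset.univ : Finset (Fin n)).biUnion
      (fun i => Fintype.piFinset fun j : Fin n => if j = i then Finset.Icc 1 K else Finset.Icc 1 N) := by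
    intro a ha
    simp only [Finset.mem_filter, Fintype.mem_piFinset, Finset.mem_Icc] at ha
    obtain ⟨ha, i, hi⟩ := ha
    simp only [Finset.mem_biUnion, Fintype.mem_piFinset, Finset.mem_univ, true_and]
    refine ⟨i, fun j => ?_⟩
    split_ifs with hj
    · subst hj
      exact Finset.mem_Icc.2 ⟨(ha _).1, hi⟩
    · exact Finset.mem_Icc.2 (ha _)
  refine (Finset.card_le_card hsub).trans (Finset.card_biUnion_le.trans (le_of_eq ?_))
  have : ∀ i : Fin n, (Fintype.piFinset fun j : Fin n =>
      if j = i then Finset.Icc 1 K else Finset.Icc 1 N).card = K * N^(n-1) := by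
    intro i
    rw [Fintype.card_piFinset, ← Finset.mul_prod_erase _ _ (Finset.mem_univ i)]
    congr 1
    · simp
    · rw [Finset.prod_congr rfl (g := fun _ => N)]
      · simp [Finset.card_erase_of_mem]
      · intro j hj
        simp [Finset.ne_of_mem_erase hj]
  simp [this]

lemma fbGood {n : ℕ} (hn : 3 ≤ n) (a : Fin n → ℕ) (ha : ∀ i, 0 < a i) (s : ℕ) (F : ℤ)
    (hs : 1 ≤ s)
    (hF : IsGreatest
            {b : ℤ | {z : Fin n → ℕ | ∑ i, (a i : ℤ) * (z i : ℤ) = b}.ncard < s} F)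
    (N : ℕ) (hN : (32 * n) ^ n ≤ N) (haN : ∀ i, a i ≤ N) (hl : ∀ i, N ≤ 4 * n * a i) :
    1/32 ≤ (F : ℝ) / ((s : ℝ) * ∏ i, (a i : ℝ)) ^ ((1 : ℝ) / ((n : ℝ) - 1)) := by
  obtain ⟨k, rfl⟩ : ∃ k, n = k + 1 := ⟨n - 1, by omega⟩
  set P : ℝ := (s : ℝ) * ∏ i, (a i : ℝ) with hP
  have hPpos : 0 < P := by
    apply mul_pos (by exact_mod_cast hs)
    exact Finset.prod_pos fun i _ => by exact_mod_cast ha i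
  set R : ℝ := P ^ ((1 : ℝ) / (((k+1:ℕ) : ℝ) - 1)) with hR
  have hRpos : 0 < R := Real.rpow_pos_of_pos hPpos _
  have hk : k ≠ 0 := by omega
  have hRP : R ^ k = P := by
    rw [hR, ← Real.rpow_natCast, ← Real.rpow_mul hPpos.le]
    have : (k:ℝ) ≠ 0 := by exact_mod_cast hk
    rw [show (1 : ℝ) / (((k+1:ℕ) : ℝ) - 1) * k = 1 by
      rw [Nat.cast_add, Nat.cast_one, add_sub_cancel_right]; exact one_div_mul_cancel this]
    simp
  have hNpos : 0 < N := lt_of_lt_of_le (by positivity) hN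
  have hprod : N ^ (k+1) ≤ (4*(k+1))^(k+1) * ∏ i, a i := by
    have : ∏ i : Fin (k+1), N ≤ ∏ i : Fin (k+1), (4*(k+1) * a i) :=
      Finset.prod_le_prod' fun i _ => hl i
    simpa [Finset.prod_mul_distrib] using this
  have h8 : (8 * N) ^ k ≤ s * ∏ i, a i := by
    have hx : (4*(k+1))^(k+1) * (8*N)^k ≤ (4*(k+1))^(k+1) * ∏ i, a i := by
      refine le_trans ?_ hprod
      calc (4*(k+1))^(k+1) * (8*N)^k = ((4*(k+1))^(k+1) * 8^k) * N^k := by rw [mul_pow 8]; ring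
        _ ≤ ((4*(k+1))^(k+1) * 8^(k+1)) * N^k := by gcongr <;> omega
        _ = (32*(k+1))^(k+1) * N^k := by rw [← mul_pow]; ring
        _ ≤ N * N^k := Nat.mul_le_mul_right _ hN
        _ = N^(k+1) := by ring
    have hy := Nat.le_of_mul_le_mul_left hx (by positivity)
    exact hy.trans (Nat.le_mul_of_pos_left _ hs)
  have h8R : (8 * N : ℝ) ≤ R := by
    apply le_of_pow_le_pow_left₀ hk hRpos.le
    rw [hRP, hP]
    exact_mod_cast h8
  set B : ℕ := ⌊R / 8⌋₊ with hB
  have hNB : N ≤ B := Nat.le_floor (by linarith)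
  have hBR : (B:ℝ) ≤ R / 8 := Nat.floor_le (by positivity)
  have hBR2 : R / 8 < B + 1 := Nat.lt_floor_add_one _
  have hB1 : (1:ℝ) ≤ B := by exact_mod_cast (by omega : 1 ≤ B)
  have hkey := fbKey hn a ha s F hs hF B (fun i => (haN i).trans hNB) (by
    have : ((2:ℝ)^(k+1+1) * (B:ℝ)^k) ≤ P := by
      calc ((2:ℝ)^(k+1+1) * (B:ℝ)^k) ≤ 2^(3*k) * (R/8)^k := by
            gcongr
            · norm_num
            · omega
        _ = R^k := by rw [pow_mul, ← mul_pow]; congr 1; norm_num; ring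
        _ = P := hRP
    rw [hP] at this
    simp only [Nat.add_sub_cancel]
    exact_mod_cast this)
  have hkey' : (B:ℝ) ≤ 2 * F := by exact_mod_cast hkey
  rw [le_div_iff₀ hRpos]
  linarith

lemma fbAll {n : ℕ} (hn : 3 ≤ n) (a : Fin n → ℕ) (ha : ∀ i, 0 < a i) (s : ℕ) (F : ℤ)
    (hs : 1 ≤ s)
    (hF : IsGreatest
            {b : ℤ | {z : Fin n → ℕ | ∑ i, (a i : ℤ) * (z i : ℤ) = b}.ncard < s} F) :
    (if ∃ i, a i ≤ 1 then (-1:ℝ) else 0) ≤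
      (F : ℝ) / ((s : ℝ) * ∏ i, (a i : ℝ)) ^ ((1 : ℝ) / ((n : ℝ) - 1)) := by
  have hP : (1:ℝ) ≤ (s : ℝ) * ∏ i, (a i : ℝ) := by
    have : 0 < s * ∏ i, a i := Nat.mul_pos hs (Finset.prod_pos fun i _ => ha i)
    exact_mod_cast this
  have hn' : (0:ℝ) ≤ (1 : ℝ) / ((n : ℝ) - 1) := by
    have : (3:ℝ) ≤ n := by exact_mod_cast hn
    apply div_nonneg <;> linarith
  have hR := Real.one_le_rpow hP hn'
  set R := ((s : ℝ) * ∏ i, (a i : ℝ)) ^ ((1 : ℝ) / ((n : ℝ) - 1))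
  have hempty : ∀ b : ℤ, (∀ z : Fin n → ℕ, ∑ i, (a i : ℤ) * (z i : ℤ) ≠ b) → b ≤ F := by
    intro b hb
    apply hF.2
    have : {z : Fin n → ℕ | ∑ i, (a i : ℤ) * (z i : ℤ) = b} = ∅ := by
      ext z; simpa using hb z
    simp only [Set.mem_ofPred_eq, this, Set.ncard_empty]
    omega
  split_ifs with h
  · have h1 : (-1:ℤ) ≤ F := hempty _ (fun z hz => by
      have : (0:ℤ) ≤ ∑ i, (a i : ℤ) * (z i : ℤ) := Finset.sum_nonneg fun i _ => by positivity
      omega)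
    have h1' : (-1:ℝ) ≤ F := by exact_mod_cast h1
    rw [le_div_iff₀ (by linarith)]
    linarith
  · push Not at h
    have h1 : (1:ℤ) ≤ F := hempty _ (fun z hz => by
      by_cases hz0 : ∀ i, z i = 0
      · simp [hz0] at hz
      · push Not at hz0
        obtain ⟨i, hi⟩ := hz0
        have h2 : (a i : ℤ) * (z i : ℤ) ≤ ∑ i, (a i : ℤ) * (z i : ℤ) :=
          Finset.single_le_sum (f := fun i => (a i : ℤ) * (z i : ℤ))
            (fun j _ => by positivity) (Finset.mem_univ i)
        have h3 : (1:ℤ) ≤ z i := by exact_mod_cast Nat.pos_of_ne_zero hi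
        have h4 : (2:ℤ) ≤ a i := by exact_mod_cast h i
        nlinarith)
    have h1' : (1:ℝ) ≤ F := by exact_mod_cast h1
    apply div_nonneg <;> linarith

/-- **Lower bound on the average normalized s-Frobenius number** (Corollary 1 ii),
lower estimate, in Aliev–Fukshansky–Henk). For `n ≥ 3` there are constants
`c' = c'_n > 0` and `T₀ = T₀(n) > 0` such that for every `s ≥ 1` and `T ≥ T₀`, the
average over `G(T)` (primitive positive integer vectors with `max aᵢ ≤ T`) of the
normalized `s`-Frobenius number `X_s(a) = F_s(a)/(s·a₁⋯aₙ)^(1/(n-1))` is at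
least `c'`. -/
theorem average_sFrobenius_lower_bound {n : ℕ} (hn : 3 ≤ n) :
    ∃ c' : ℝ, 0 < c' ∧ ∃ T₀ : ℝ, 0 < T₀ ∧
      ∀ F : (Fin n → ℕ) → ℕ → ℤ,
        (∀ (a : Fin n → ℕ) (s : ℕ), (∀ i, 0 < a i) → Finset.univ.gcd a = 1 → 1 ≤ s →
          IsGreatest
            {b : ℤ | {z : Fin n → ℕ | ∑ i, (a i : ℤ) * (z i : ℤ) = b}.ncard < s}
            (F a s)) →
      ∀ s : ℕ, 1 ≤ s → ∀ T : ℝ, T₀ ≤ T →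
      ∀ G : Finset (Fin n → ℕ),
        (∀ a, a ∈ G ↔ ((∀ i, 0 < a i) ∧ Finset.univ.gcd a = 1 ∧ ∀ i, (a i : ℝ) ≤ T)) →
        c' ≤ (1 / (G.card : ℝ)) * ∑ a ∈ G,
            (F a s : ℝ) / ((s : ℝ) * ∏ i, (a i : ℝ)) ^ ((1 : ℝ) / ((n : ℝ) - 1)) := by
  refine ⟨1/256, by norm_num, ((32 * n) ^ n : ℕ), by
    have : 0 < (32 * n) ^ n := by positivity
    exact_mod_cast this, ?_⟩
  intro F hF s hs T hT G hG
  have hT0 : 0 ≤ T := le_trans (by positivity) hT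
  set N := ⌊T⌋₊ with hNdef
  have hN : (32 * n) ^ n ≤ N := Nat.le_floor hT
  set Q := Fintype.piFinset fun _ : Fin n => Finset.Icc 1 N with hQ
  have hGQ : G = Q.filter (fun a => Finset.univ.gcd a = 1) := by
    ext a
    rw [hG]
    simp only [hQ, Finset.mem_filter, Fintype.mem_piFinset, Finset.mem_Icc, hNdef,
      Nat.le_floor_iff hT0]
    constructor
    · rintro ⟨h1, h2, h3⟩
      exact ⟨fun i => ⟨h1 i, h3 i⟩, h2⟩
    · rintro ⟨h1, h2⟩
      exact ⟨fun i => (h1 i).1, h2, fun i => (h1 i).2⟩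
  have hGsub : G ⊆ Q := hGQ ▸ Finset.filter_subset _ _
  have hN32 : 256 * n ≤ N := by
    refine le_trans ?_ hN
    calc 256 * n ≤ (32 * n) ^ 2 := by nlinarith
      _ ≤ _ := Nat.pow_le_pow_right (by omega) (by omega)
  have hNpos : 0 < N := by omega
  have hGprim : (N:ℝ)^n / 2 ≤ (G.card : ℝ) := by rw [hGQ]; exact fbPrim hn N
  have hGle : (G.card : ℝ) ≤ (N:ℝ)^n := by
    have := Finset.card_le_card hGsub
    have hQc : Q.card = N ^ n := by simp [hQ]
    rw [hQc] at this
    exact_mod_cast this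
  have hNn : (0:ℝ) < (N:ℝ)^n := by positivity
  set K := N / (4 * n) with hK
  have hnR : (0:ℝ) < n := by exact_mod_cast (by omega : 0 < n)
  have hpow : (N:ℝ) * (N:ℝ)^(n-1) = (N:ℝ)^n := by
    rw [← pow_succ']; congr 1; omega
  have hpos' : (0:ℝ) ≤ (N:ℝ)^(n-1) := by positivity
  -- small coordinate sets
  have hsmallK : ((G.filter (fun a => ∃ i, a i ≤ K)).card : ℝ) ≤ (N:ℝ)^n / 4 := by
    have h1 : (G.filter (fun a => ∃ i, a i ≤ K)).card ≤ n * (K * N^(n-1)) :=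
      (Finset.card_le_card (Finset.filter_subset_filter _ hGsub)).trans (fbSmall (by omega) N K)
    have h2 : 4 * n * K ≤ N := Nat.mul_div_le N (4*n)
    have h1' : ((G.filter (fun a => ∃ i, a i ≤ K)).card : ℝ) ≤ n * (K * (N:ℝ)^(n-1)) := by
      exact_mod_cast h1
    have h2' : (4:ℝ) * n * K ≤ N := by exact_mod_cast h2
    have := mul_le_mul_of_nonneg_right h2' hpos'
    nlinarith
  have hsmall1 : ((G.filter (fun a => ∃ i, a i ≤ 1)).card : ℝ) ≤ (N:ℝ)^n / 256 := by
    have h1 : (G.filter (fun a => ∃ i, a i ≤ 1)).card ≤ n * (1 * N^(n-1)) :=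
      (Finset.card_le_card (Finset.filter_subset_filter _ hGsub)).trans (fbSmall (by omega) N 1)
    have h1' : ((G.filter (fun a => ∃ i, a i ≤ 1)).card : ℝ) ≤ n * (1 * (N:ℝ)^(n-1)) := by
      exact_mod_cast h1
    have h2' : (256:ℝ) * n ≤ N := by exact_mod_cast hN32
    have := mul_le_mul_of_nonneg_right h2' hpos'
    nlinarith
  have hgood : (N:ℝ)^n / 4 ≤ ((G.filter (fun a => ¬ ∃ i, a i ≤ K)).card : ℝ) := by
    have h := Finset.card_filter_add_card_filter_not (s := G) (fun a => ∃ i, a i ≤ K)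
    have h' : ((G.filter (fun a => ∃ i, a i ≤ K)).card : ℝ) +
      ((G.filter (fun a => ¬ ∃ i, a i ≤ K)).card : ℝ) = G.card := by exact_mod_cast h
    linarith
  have hpt : ∀ a ∈ G, (if ¬ ∃ i, a i ≤ K then (1/32:ℝ) else 0) + (if ∃ i, a i ≤ 1 then (-1:ℝ) else 0)
      ≤ (F a s : ℝ) / ((s : ℝ) * ∏ i, (a i : ℝ)) ^ ((1 : ℝ) / ((n : ℝ) - 1)) := by
    intro a haG
    obtain ⟨h1, h2, h3⟩ := (hG a).1 haG
    have hFa := hF a s h1 h2 hs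
    have hall := fbAll hn a h1 s _ hs hFa
    by_cases hc : ∃ i, a i ≤ K
    · rw [if_neg (not_not.2 hc), zero_add]
      exact hall
    · rw [if_pos hc]
      have hg := fbGood hn a h1 s _ hs hFa N hN (fun i => Nat.le_floor (h3 i)) (by
        intro i
        push Not at hc
        have := (Nat.div_lt_iff_lt_mul (by omega : 0 < 4 * n)).1 (hc i)
        nlinarith)
      have : (if ∃ i, a i ≤ 1 then (-1:ℝ) else 0) ≤ 0 := by split_ifs <;> norm_num
      linarith
  have hsum := Finset.sum_le_sum hpt
  rw [Finset.sum_add_distrib, ← Finset.sum_filter, ← Finset.sum_filter, Finset.sum_const,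
    Finset.sum_const, nsmul_eq_mul, nsmul_eq_mul] at hsum
  rw [one_div_mul_eq_div, le_div_iff₀ (by linarith)]
  linarith
end
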